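/- arXiv:0804.0167 — 8 statements merged into one kernel-verified Lean document; each statement's English description precedes it below -/
import Mathlib

section
/- Let (𝒫_n)_{n≥1} be a sequence of finite collections of pairwise disjoint open arcs of the circle S¹ such that: (a) for each n the union of the arcs in 𝒫_n has full λ-measure, (b) every arc of 𝒫_n coincides, up to a λ-null set, with a union of arcs of 𝒫_{n+1}, and (c) the maximal diameter of the arcs of 𝒫_n tends to 0 as n → ∞. Then for every measurable set A ⊆ S¹ with λ(A) > 0 there exists a sequence of arcs I_n ∈ 𝒫_n such that λ(A ∩ I_n)/λ(I_n) → 1 as n → ∞. -/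
open MeasureTheory Filter Topology

/-- An open arc of the circle `S¹ = ℝ/ℤ`: the image in `S¹` of an open interval
of `ℝ` of length less than `1`. -/
def IsOpenArc (I : Set (AddCircle (1 : ℝ))) : Prop :=
  ∃ a b : ℝ, a < b ∧ b - a < 1 ∧ I = (fun x : ℝ => (x : AddCircle (1 : ℝ))) '' Set.Ioo a b

lemma arc_eq_ball {I : Set (AddCircle (1 : ℝ))} (h : IsOpenArc I) :
    ∃ (c : AddCircle (1 : ℝ)) (r : ℝ), 0 < r ∧ 2 * r < 1 ∧ I = Metric.ball c r := by
  obtain ⟨a, b, hab, hlt, rfl⟩ := h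
  refine ⟨(((a + b) / 2 : ℝ) : AddCircle (1 : ℝ)), (b - a) / 2, by linarith, by linarith, ?_⟩
  ext y
  induction y using QuotientAddGroup.induction_on with
  | H y =>
  rw [Metric.mem_ball, dist_eq_norm]
  constructor
  · rintro ⟨x, hx, hxy⟩
    simp only at hxy
    rw [← hxy, ← AddCircle.coe_sub]
    have h1 : ‖((x - (a + b) / 2 : ℝ) : AddCircle (1 : ℝ))‖ ≤ |x - (a + b) / 2| := by
      rw [AddCircle.norm_eq]
      simpa using round_le (x - (a + b) / 2) 0
    refine h1.trans_lt ?_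
    rw [abs_lt]
    constructor <;> linarith [hx.1, hx.2]
  · intro hy
    have hy2 : ‖((y - (a + b) / 2 : ℝ) : AddCircle (1 : ℝ))‖ < (b - a) / 2 := hy
    rw [AddCircle.norm_eq] at hy2
    simp only [inv_one, one_mul, mul_one, abs_lt] at hy2
    refine ⟨y - round (y - (a + b) / 2), ⟨by linarith [hy2.1], by linarith [hy2.2]⟩, ?_⟩
    have : ((round (y - (a + b) / 2) : ℝ) : AddCircle (1 : ℝ)) = 0 := by
      rw [AddCircle.coe_eq_zero_iff]
      exact ⟨round (y - (a + b) / 2), by simp⟩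
    simp only [AddCircle.coe_sub, this, sub_zero]

theorem stmt0
    (P : ℕ → Finset (Set (AddCircle (1 : ℝ))))
    (harc : ∀ n, ∀ I ∈ P n, IsOpenArc I)
    (hdisj : ∀ n, ∀ I ∈ P n, ∀ J ∈ P n, I ≠ J → Disjoint I J)
    (hfull : ∀ n, volume (⋃ I ∈ P n, I) = 1)
    (hrefine : ∀ n, ∀ I ∈ P n, ∃ S : Finset (Set (AddCircle (1 : ℝ))),
      S ⊆ P (n + 1) ∧ volume (symmDiff I (⋃ J ∈ S, J)) = 0)
    (hdiam : ∀ ε > 0, ∃ N : ℕ, ∀ n ≥ N, ∀ I ∈ P n, Metric.diam I < ε)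
    (A : Set (AddCircle (1 : ℝ))) (hA : MeasurableSet A) (hApos : 0 < volume A) :
    ∃ I : ℕ → Set (AddCircle (1 : ℝ)), (∀ n, I n ∈ P n) ∧
      Tendsto (fun n => volume (A ∩ I n) / volume (I n)) atTop (𝓝 1) := by
  have hopen : ∀ n, ∀ I ∈ P n, IsOpen I := by
    intro n I hI
    obtain ⟨c, r, -, -, rfl⟩ := arc_eq_ball (harc n I hI)
    exact Metric.isOpen_ball
  have huniv : volume (Set.univ : Set (AddCircle (1 : ℝ))) = 1 := by
    simp
  have hcov : ∀ᵐ x : AddCircle (1 : ℝ), ∀ n, x ∈ ⋃ I ∈ P n, I := by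
    rw [ae_all_iff]
    intro n
    have hm : MeasurableSet (⋃ I ∈ P n, I) :=
      (isOpen_biUnion fun I hI => hopen n I hI).measurableSet
    rw [ae_iff]
    change volume (⋃ I ∈ P n, I)ᶜ = 0
    rw [measure_compl hm (by rw [hfull]; simp), hfull, huniv, tsub_self]
  have hdens := IsUnifLocDoublingMeasure.ae_tendsto_measure_inter_div
    (volume : Measure (AddCircle (1 : ℝ))) A 1
  have hne : (volume.restrict A : Measure (AddCircle (1 : ℝ))) ≠ 0 := by
    intro h
    rw [Measure.restrict_eq_zero] at h
    exact hApos.ne' h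
  haveI : (ae (volume.restrict A : Measure (AddCircle (1 : ℝ)))).NeBot := ae_neBot.2 hne
  obtain ⟨x, hx, hxc⟩ := (hdens.and (ae_restrict_of_ae hcov)).exists
  have hI : ∀ n, ∃ I ∈ P n, x ∈ I := fun n => by simpa using hxc n
  choose I hIP hxI using hI
  choose c r hr0 hr1 hIb using fun n => arc_eq_ball (harc n (I n) (hIP n))
  refine ⟨I, hIP, ?_⟩
  have hae : ∀ n, I n =ᵐ[volume] Metric.closedBall (c n) (r n) := fun n => by
    rw [hIb n]; exact (AddCircle.closedBall_ae_eq_ball).symm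
  have hvol : ∀ n, volume (I n) = ENNReal.ofReal (2 * r n) := fun n => by
    rw [measure_congr (hae n), AddCircle.volume_closedBall, min_eq_right (hr1 n).le]
  have hrd : ∀ n, r n ≤ Metric.diam (I n) := fun n => by
    have hsub : I n ⊆ Metric.closedBall x (Metric.diam (I n)) := fun y hy =>
      Metric.dist_le_diam_of_mem (Metric.isBounded_of_compactSpace) hy (hxI n)
    have h := measure_mono (μ := volume) hsub
    rw [hvol, AddCircle.volume_closedBall] at h
    have h2 := (ENNReal.ofReal_le_ofReal_iff
      (le_min zero_le_one (by positivity))).1 h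
    linarith [h2.trans (min_le_right _ _)]
  have hlim : Tendsto r atTop (𝓝[>] 0) := by
    rw [tendsto_nhdsWithin_iff]
    refine ⟨?_, Eventually.of_forall hr0⟩
    rw [Metric.tendsto_atTop]
    intro ε hε
    obtain ⟨N, hN⟩ := hdiam ε hε
    refine ⟨N, fun n hn => ?_⟩
    rw [Real.dist_eq, sub_zero, abs_of_pos (hr0 n)]
    exact (hrd n).trans_lt (hN n hn _ (hIP n))
  have h := hx c r hlim (Eventually.of_forall fun n => by
    rw [one_mul]
    have := hxI n
    rw [hIb n] at this
    exact Metric.ball_subset_closedBall this)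
  refine h.congr fun n => ?_
  rw [measure_congr (hae n), measure_congr ((ae_eq_refl A).inter (hae n))]
end

section
/- Let (X, d) be a compact metric space, let μ be a uniformly locally doubling Borel probability measure on X, and let f : X → X be a surjective isometry that preserves μ and has a dense orbit (there exists x₀ ∈ X such that {fⁿ(x₀) : n ∈ ℕ} is dense in X). Then f is ergodic with respect to μ. -/
open MeasureTheory Filter

theorem orbit_close {X : Type*} [MetricSpace X] (f : X → X) (hsurj : Function.Surjective f)
    (hiso : Isometry f) (hdense : ∃ x₀ : X, Dense (Set.range fun n : ℕ => f^[n] x₀))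
    (x y : X) (ε : ℝ) (hε : 0 < ε) : ∃ n : ℕ, dist y (f^[n] x) ≤ ε := by
  obtain ⟨x₀, h⟩ := hdense
  have hit : ∀ n, Isometry (f^[n]) := fun n => by
    induction n with
    | zero => exact isometry_id
    | succ n ih => exact ih.comp hiso
  obtain ⟨_, ⟨m, rfl⟩, hm⟩ := h.exists_dist_lt x (half_pos hε)
  obtain ⟨z, rfl⟩ := hsurj.iterate m y
  obtain ⟨_, ⟨n, rfl⟩, hn⟩ := h.exists_dist_lt z (half_pos hε)
  refine ⟨n, ?_⟩
  rw [← (hit n).dist_eq] at hm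
  rw [← (hit m).dist_eq] at hn
  simp only [← Function.iterate_add_apply] at hm hn
  rw [add_comm m n] at hn
  have := dist_triangle_right (f^[m] z) (f^[n] x) (f^[n+m] x₀)
  linarith

/-- A surjective isometry of a compact metric space with a dense orbit, preserving a
uniformly locally doubling Borel probability measure, is ergodic. -/
theorem stmt2 {X : Type*} [MetricSpace X] [CompactSpace X]
    [MeasurableSpace X] [BorelSpace X]
    (μ : Measure X) [IsProbabilityMeasure μ] [IsUnifLocDoublingMeasure μ]
    (f : X → X) (hsurj : Function.Surjective f) (hiso : Isometry f)
    (hpres : MeasurePreserving f μ μ)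
    (hdense : ∃ x₀ : X, Dense (Set.range fun n : ℕ => f^[n] x₀)) :
    Ergodic f μ := by
  refine ⟨hpres, ⟨fun {A} hA hinv => ?_⟩⟩
  rw [eventuallyConst_set']
  by_contra hcon
  push Not at hcon
  obtain ⟨h0, h1⟩ := hcon
  have h0' : μ A ≠ 0 := fun h => h0 (ae_eq_empty.2 h)
  have h1' : μ Aᶜ ≠ 0 := fun h => h1 (ae_eq_univ.2 h)
  have key : ∀ S : Set X, μ S ≠ 0 → ∃ x, ∀ (w : ℕ → X) (δ : ℕ → ℝ)
      (_ : Tendsto δ atTop (nhdsWithin 0 (Set.Ioi 0)))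
      (_ : ∀ᶠ j in atTop, x ∈ Metric.closedBall (w j) (1 * δ j)),
      Tendsto (fun j => μ (S ∩ Metric.closedBall (w j) (δ j)) / μ (Metric.closedBall (w j) (δ j)))
        atTop (nhds 1) := by
    intro S hS
    have hae := IsUnifLocDoublingMeasure.ae_tendsto_measure_inter_div μ S 1
    have : NeBot (ae (μ.restrict S)) := by
      rw [ae_neBot]; simpa using hS
    obtain ⟨x, hx⟩ := hae.exists
    exact ⟨x, fun w δ => hx w δ⟩
  obtain ⟨x, hx⟩ := key A h0'
  obtain ⟨y, hy⟩ := key Aᶜ h1'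
  have hit : ∀ n, Isometry (f^[n]) := fun n => by
    induction n with
    | zero => exact isometry_id
    | succ n ih => exact ih.comp hiso
  have hinvn : ∀ n, f^[n] ⁻¹' A = A := fun n => by
    induction n with
    | zero => rfl
    | succ n ih => rw [Function.iterate_succ, Set.preimage_comp, ih, hinv]
  let δ : ℕ → ℝ := fun j => 1 / ((j : ℝ) + 1)
  have hpos : ∀ j, 0 < δ j := fun j => by positivity
  have hδ : Tendsto δ atTop (nhdsWithin 0 (Set.Ioi 0)) :=
    tendsto_nhdsWithin_iff.2 ⟨tendsto_one_div_add_atTop_nhds_zero_nat, .of_forall hpos⟩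
  choose n hn using fun j => orbit_close f hsurj hiso hdense x y (δ j) (hpos j)
  have t1 := hx (fun _ => x) δ hδ (.of_forall fun j => by simpa using (hpos j).le)
  have t2 := hy (fun j => f^[n j] x) δ hδ (.of_forall fun j => by simpa using hn j)
  have e : ∀ j, μ (A ∩ Metric.closedBall x (δ j)) / μ (Metric.closedBall x (δ j)) =
      μ (A ∩ Metric.closedBall (f^[n j] x) (δ j)) / μ (Metric.closedBall (f^[n j] x) (δ j)) := by
    intro j
    rw [← (hpres.iterate (n j)).measure_preimage
        (hA.inter (Metric.isClosed_closedBall (x := f^[n j] x)).measurableSet).nullMeasurableSet,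
      ← (hpres.iterate (n j)).measure_preimage
        (Metric.isClosed_closedBall (x := f^[n j] x)).measurableSet.nullMeasurableSet,
      Set.preimage_inter, hinvn, (hit _).preimage_closedBall]
  simp only [e] at t1
  have t3 := t1.add t2
  have := le_of_tendsto' t3 (b := 1) (fun j => by
    rw [← ENNReal.add_div, Set.inter_comm A, Set.inter_comm Aᶜ, ← Set.sdiff_eq,
      measure_inter_add_sdiff _ hA]
    exact ENNReal.div_self_le_one)
  norm_num at this
end

section
/- Let F : ℝ → ℝ be differentiable with F'(x) > 0 for all x, and suppose the function α(x) = log(F'(x)) is Lipschitz continuous with constant L > 0. Let C > 0 and μ > 1 be constants. Set K = exp(L·C⁻¹·μ⁻¹·(1 − μ⁻¹)⁻¹). Then for every n ∈ ℕ and all x, y ∈ ℝ satisfying |Fⁱ(x) − Fⁱ(y)| ≤ C⁻¹·μ^{−(n−i)} for every 0 ≤ i ≤ n−1, one has K⁻¹ ≤ (Fⁿ)'(x)/(Fⁿ)'(y) ≤ K, where (Fⁿ)'(x) = ∏_{i=0}^{n−1} F'(Fⁱ(x)) is the derivative of the n-th iterate Fⁿ = F ∘ ⋯ ∘ F. -/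
open Filter

/-- Distortion estimate: if `F : ℝ → ℝ` is differentiable with positive derivative
everywhere, and `α = log ∘ (deriv F)` is Lipschitz with constant `L > 0`, then with
`K = exp (L C⁻¹ μ⁻¹ (1 - μ⁻¹)⁻¹)`, for any `n` and any points `x, y` whose first `n`
iterates satisfy `|Fⁱx - Fⁱy| ≤ C⁻¹ μ^{-(n-i)}`, the ratio of the derivatives
`(Fⁿ)'(x) / (Fⁿ)'(y) = ∏_{i<n} F'(Fⁱx) / ∏_{i<n} F'(Fⁱy)` lies in `[K⁻¹, K]`. -/
theorem stmt4 (F : ℝ → ℝ) (hF : Differentiable ℝ F)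
    (hpos : ∀ x : ℝ, 0 < deriv F x)
    (L : NNReal) (hL : 0 < L)
    (hlip : LipschitzWith L fun x => Real.log (deriv F x))
    (C μ : ℝ) (hC : 0 < C) (hμ : 1 < μ)
    (K : ℝ) (hK : K = Real.exp ((L : ℝ) * C⁻¹ * μ⁻¹ * (1 - μ⁻¹)⁻¹))
    (n : ℕ) (x y : ℝ)
    (hclose : ∀ i < n, |F^[i] x - F^[i] y| ≤ C⁻¹ * (μ ^ (n - i))⁻¹) :
    K⁻¹ ≤ (∏ i ∈ Finset.range n, deriv F (F^[i] x)) /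
        (∏ i ∈ Finset.range n, deriv F (F^[i] y)) ∧
      (∏ i ∈ Finset.range n, deriv F (F^[i] x)) /
        (∏ i ∈ Finset.range n, deriv F (F^[i] y)) ≤ K := by
  have hμ0 : 0 < μ := by linarith
  have hr0 : 0 ≤ μ⁻¹ := by positivity
  have hr1 : μ⁻¹ < 1 := inv_lt_one_of_one_lt₀ hμ
  have hgeo : ∑ i ∈ Finset.range n, (μ ^ (n - i))⁻¹ ≤ μ⁻¹ * (1 - μ⁻¹)⁻¹ := by
    have h1 : ∑ i ∈ Finset.range n, (μ ^ (n - i))⁻¹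
        = ∑ j ∈ Finset.range n, μ⁻¹ * μ⁻¹ ^ j := by
      rw [← Finset.sum_range_reflect (fun j => μ⁻¹ * μ⁻¹ ^ j) n]
      refine Finset.sum_congr rfl fun i hi => ?_
      have hi' := Finset.mem_range.mp hi
      rw [← pow_succ', inv_pow]
      congr 2
      omega
    rw [h1, ← Finset.mul_sum]
    refine mul_le_mul_of_nonneg_left ?_ hr0
    rw [← tsum_geometric_of_lt_one hr0 hr1]
    exact (summable_geometric_of_lt_one hr0 hr1).sum_le_tsum _ (fun j _ => pow_nonneg hr0 j)
  have hratio : (∏ i ∈ Finset.range n, deriv F (F^[i] x)) /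
        (∏ i ∈ Finset.range n, deriv F (F^[i] y)) =
      Real.exp (∑ i ∈ Finset.range n,
        (Real.log (deriv F (F^[i] x)) - Real.log (deriv F (F^[i] y)))) := by
    rw [Real.exp_sum, ← Finset.prod_div_distrib]
    refine Finset.prod_congr rfl fun i _ => ?_
    rw [Real.exp_sub, Real.exp_log (hpos _), Real.exp_log (hpos _)]
  have hb : |∑ i ∈ Finset.range n,
        (Real.log (deriv F (F^[i] x)) - Real.log (deriv F (F^[i] y)))| ≤
      (L : ℝ) * C⁻¹ * μ⁻¹ * (1 - μ⁻¹)⁻¹ := by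
    calc _ ≤ ∑ i ∈ Finset.range n,
          |Real.log (deriv F (F^[i] x)) - Real.log (deriv F (F^[i] y))| :=
          Finset.abs_sum_le_sum_abs _ _
      _ ≤ ∑ i ∈ Finset.range n, (L : ℝ) * C⁻¹ * (μ ^ (n - i))⁻¹ := by
          refine Finset.sum_le_sum fun i hi => ?_
          have h := hlip.dist_le_mul (F^[i] x) (F^[i] y)
          rw [Real.dist_eq, Real.dist_eq] at h
          refine h.trans ?_
          rw [mul_assoc]
          exact mul_le_mul_of_nonneg_left (hclose i (Finset.mem_range.mp hi)) L.coe_nonneg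
      _ ≤ (L : ℝ) * C⁻¹ * (μ⁻¹ * (1 - μ⁻¹)⁻¹) := by
          rw [← Finset.mul_sum]
          exact mul_le_mul_of_nonneg_left hgeo (by positivity)
      _ = _ := by ring
  rw [hratio, hK, ← Real.exp_neg, Real.exp_le_exp, Real.exp_le_exp]
  exact abs_le.mp hb
end

section
/- Let f : S¹ → S¹ be a C² expanding circle map of degree d ≥ 2, and assume f preserves the Haar measure λ. Then f is ergodic with respect to λ. -/
open MeasureTheory

namespace S5

lemma iter_diff {F : ℝ → ℝ} (hF : Differentiable ℝ F) (n : ℕ) : Differentiable ℝ (F^[n]) := by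
  induction n with
  | zero => simpa using differentiable_id
  | succ n ih => rw [Function.iterate_succ']; exact hF.comp ih

lemma deriv_iter {F : ℝ → ℝ} (hF : Differentiable ℝ F) (n : ℕ) (u : ℝ) :
    deriv (F^[n+1]) u = deriv F (F^[n] u) * deriv (F^[n]) u := by
  rw [Function.iterate_succ', deriv_comp _ (hF _) (iter_diff hF n _)]

lemma lip {F : ℝ → ℝ} {d : ℕ} (hsmooth : ContDiff ℝ 2 F)
    (hdeg : ∀ x : ℝ, F (x + 1) = F x + d) :
    ∃ L : ℝ, 0 ≤ L ∧ ∀ a b, |deriv F a - deriv F b| ≤ L * |a - b| := by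
  have h1 : ContDiff ℝ 1 (deriv F) := by
    have := (contDiff_succ_iff_deriv (n := 1) (f := F) (𝕜 := ℝ)).1 (by rw [one_add_one_eq_two]; exact hsmooth)
    exact this.2.2
  have hc : Continuous (deriv (deriv F)) := h1.continuous_deriv le_rfl
  have hp1 : ∀ x, deriv F (x + 1) = deriv F x := by
    intro x
    rw [← deriv_comp_add_const]
    have : (fun x => F (x + 1)) = fun x => F x + d := funext hdeg
    rw [this, deriv_add_const]
  have hp2 : Function.Periodic (deriv (deriv F)) 1 := by
    intro x
    rw [← deriv_comp_add_const]
    have : (fun x => deriv F (x + 1)) = deriv F := funext hp1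
    rw [this]
  obtain ⟨L, hL⟩ := isCompact_Icc.exists_bound_of_continuousOn (s := Set.Icc (0:ℝ) 1)
    hc.continuousOn
  have hb : ∀ x, ‖deriv (deriv F) x‖ ≤ L := by
    intro x
    obtain ⟨y, hy, hxy⟩ := hp2.exists_mem_Ico₀ one_pos x
    rw [hxy]; exact hL y ⟨hy.1, hy.2.le⟩
  refine ⟨L, (norm_nonneg _).trans (hb 0), fun a b => ?_⟩
  exact Convex.norm_image_sub_le_of_norm_deriv_le
    (fun x _ => (h1.differentiable one_ne_zero) x) (fun x _ => hb x) convex_univ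
    (Set.mem_univ b) (Set.mem_univ a)

lemma distort {F : ℝ → ℝ} (hF : Differentiable ℝ F) {L m : ℝ} (hm : 0 < m)
    (hL : 0 ≤ L) (hlip : ∀ a b, |deriv F a - deriv F b| ≤ L * |a - b|)
    (hge : ∀ a, m ≤ deriv F a) (hpos : ∀ n x, 0 < deriv (F^[n]) x) (u v : ℝ) (n : ℕ) :
    deriv (F^[n]) u ≤ deriv (F^[n]) v *
      Real.exp (L / m * ∑ k ∈ Finset.range n, |F^[k] u - F^[k] v|) := by
  induction n with
  | zero => simp
  | succ n ih =>
    rw [deriv_iter hF, deriv_iter hF, Finset.sum_range_succ, mul_add, Real.exp_add]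
    set a := F^[n] u
    set b := F^[n] v
    have h1 : deriv F a ≤ deriv F b * Real.exp (L / m * |a - b|) := by
      have h2 := (abs_le.1 (hlip a b)).2
      have h3 := Real.add_one_le_exp (L / m * |a - b|)
      have h4 : L * |a - b| ≤ deriv F b * (L / m * |a - b|) := by
        have : L * |a - b| = m * (L / m * |a - b|) := by field_simp
        rw [this]
        exact mul_le_mul_of_nonneg_right (hge b) (by positivity)
      nlinarith [hge b]
    calc _ ≤ (deriv F b * Real.exp (L / m * |a - b|)) * _ :=
          mul_le_mul h1 ih (hpos n u).le
            (mul_nonneg (hm.le.trans (hge b)) (Real.exp_pos _).le)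
      _ = _ := by ring

lemma sum_bound {F : ℝ → ℝ} (hF : Differentiable ℝ F) {C μ : ℝ} (hC : 0 < C) (hμ : 1 < μ)
    (hexp : ∀ x : ℝ, ∀ n : ℕ, C * μ ^ n ≤ deriv (F^[n]) x) (u v : ℝ) (n : ℕ)
    (h : |F^[n] u - F^[n] v| ≤ 1) :
    ∑ k ∈ Finset.range n, |F^[k] u - F^[k] v| ≤ 1 / C * (1 - μ⁻¹)⁻¹ := by
  have hμ0 : 0 < μ := by linarith
  have key : ∀ j a b, C * μ ^ j * |a - b| ≤ |F^[j] a - F^[j] b| := by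
    intro j a b
    wlog hab : b ≤ a generalizing a b
    · rw [abs_sub_comm a, abs_sub_comm (F^[j] a)]; exact this b a (le_of_not_ge hab)
    rw [abs_of_nonneg (sub_nonneg.2 hab)]
    exact (mul_sub_le_image_sub_of_le_deriv (iter_diff hF j) (fun x => hexp x j) hab).trans
      (le_abs_self _)
  calc ∑ k ∈ Finset.range n, |F^[k] u - F^[k] v|
      ≤ ∑ k ∈ Finset.range n, 1 / C * (μ⁻¹) ^ (n - 1 - k) := by
        apply Finset.sum_le_sum
        intro k hk
        have hk := Finset.mem_range.1 hk
        have h1 := key (n - k) (F^[k] u) (F^[k] v)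
        rw [← Function.iterate_add_apply, ← Function.iterate_add_apply,
          Nat.sub_add_cancel hk.le] at h1
        have h2 := h1.trans h
        have h3 : |F^[k] u - F^[k] v| ≤ 1 / C * (μ⁻¹) ^ (n - k) := by
          rw [inv_pow, ← one_div, one_div_mul_one_div, le_div_iff₀ (by positivity)]
          linarith
        refine h3.trans ?_
        gcongr 1 / C * ?_
        exact pow_le_pow_of_le_one (by positivity) (inv_le_one_of_one_le₀ hμ.le) (by omega)
    _ = 1 / C * ∑ k ∈ Finset.range n, (μ⁻¹) ^ k := by
        rw [← Finset.mul_sum, Finset.sum_range_reflect (fun k => (μ⁻¹) ^ k)]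
    _ ≤ _ := by
        gcongr
        rw [← tsum_geometric_of_lt_one (by positivity) (inv_lt_one_of_one_lt₀ hμ)]
        exact (summable_geometric_of_lt_one (by positivity)
          (inv_lt_one_of_one_lt₀ hμ)).sum_le_tsum _ (fun i _ => by positivity)

/-- Small intervals on which `A` has definite proportion. -/
lemma main {F : ℝ → ℝ} {d : ℕ} (hsmooth : ContDiff ℝ 2 F)
    (hdeg : ∀ x : ℝ, F (x + 1) = F x + d) {C μ : ℝ} (hC : 0 < C) (hμ : 1 < μ)
    (hexp : ∀ x : ℝ, ∀ n : ℕ, C * μ ^ n ≤ deriv (F^[n]) x)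
    {A : Set ℝ} (hA : MeasurableSet A) (hinv : F ⁻¹' A = A) {c : ℝ} (hc : 0 < c)
    (hAc : ∀ a, c ≤ volume.real (A ∩ Set.Ioc a (a + 1))) :
    ∃ ε : ℝ, 0 < ε ∧ ∀ x n, ∃ y, x < y ∧ y - x ≤ 1 / (C * μ ^ n) ∧
      ε * (y - x) ≤ volume.real (A ∩ Set.Icc x y) := by
  have hF : Differentiable ℝ F := hsmooth.differentiable two_ne_zero
  have hμ0 : 0 < μ := by linarith
  obtain ⟨L, hL, hlip⟩ := lip hsmooth hdeg
  have hge : ∀ a, C * μ ≤ deriv F a := fun a => by simpa using hexp a 1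
  have hpos : ∀ n x, 0 < deriv (F^[n]) x := fun n x =>
    lt_of_lt_of_le (by positivity) (hexp x n)
  set K := Real.exp (L / (C * μ) * (1 / C * (1 - μ⁻¹)⁻¹)) with hK
  have hK0 : 0 < K := Real.exp_pos _
  refine ⟨c / (K * K), by positivity, fun x n => ?_⟩
  have hG := iter_diff hF n
  have hmono : StrictMono (F^[n]) := strictMono_of_deriv_pos (hpos n)
  have hr : 0 < 1 / (C * μ ^ n) := by positivity
  obtain ⟨y, hy, hGy⟩ : F^[n] x + 1 ∈ F^[n] '' Set.Icc x (x + 1 / (C * μ ^ n)) := by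
    apply intermediate_value_Icc (by linarith) hG.continuous.continuousOn
    refine ⟨by linarith, ?_⟩
    have := mul_sub_le_image_sub_of_le_deriv hG (fun z => hexp z n)
      (show x ≤ x + 1 / (C * μ ^ n) by linarith)
    rw [add_sub_cancel_left, mul_one_div_cancel (by positivity)] at this
    linarith
  have hxy : x < y := hmono.lt_iff_lt.1 (by linarith)
  refine ⟨y, hxy, by linarith [hy.2], ?_⟩
  have hdist : ∀ u ∈ Set.Icc x y, ∀ v ∈ Set.Icc x y,
      deriv (F^[n]) u ≤ deriv (F^[n]) v * K := by
    intro u hu v hv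
    refine (distort hF (by positivity) hL hlip hge hpos u v n).trans ?_
    refine mul_le_mul_of_nonneg_left (Real.exp_le_exp.2 ?_) (hpos n v).le
    refine mul_le_mul_of_nonneg_left (sum_bound hF hC hμ hexp u v n ?_) (by positivity)
    have h1 := hmono.monotone hu.1
    have h2 := hmono.monotone hu.2
    have h3 := hmono.monotone hv.1
    have h4 := hmono.monotone hv.2
    rw [abs_le]; constructor <;> linarith
  have hx : x ∈ Set.Icc x y := ⟨le_rfl, hxy.le⟩
  set D := deriv (F^[n]) x with hD
  have hD0 : 0 < D := hpos n x
  have hlen : D * (y - x) ≤ K := by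
    obtain ⟨z, hz, hz'⟩ := exists_deriv_eq_slope (F^[n]) hxy hG.continuous.continuousOn
      hG.differentiableOn
    rw [hGy, add_sub_cancel_left, eq_div_iff (by linarith)] at hz'
    have := hdist x hx z ⟨hz.1.le, hz.2.le⟩
    have h5 : D * (y - x) ≤ deriv (F^[n]) z * K * (y - x) :=
      mul_le_mul_of_nonneg_right this (by linarith)
    nlinarith
  have hinvn : ∀ n, (F^[n]) ⁻¹' A = A := by
    intro n
    induction n with
    | zero => rfl
    | succ n ih => rw [Function.iterate_succ', Set.preimage_comp, hinv, ih]
  have hfin : volume (A ∩ Set.Icc x y) ≠ ⊤ :=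
    measure_ne_top_of_subset Set.inter_subset_right (by simp)
  have himg : A ∩ Set.Ioc (F^[n] x) (F^[n] x + 1) ⊆ F^[n] '' (A ∩ Set.Icc x y) := by
    rintro z ⟨hzA, hz⟩
    rw [← hGy] at hz
    obtain ⟨w, hw, rfl⟩ := intermediate_value_Icc hxy.le hG.continuous.continuousOn
      ⟨hz.1.le, hz.2⟩
    refine ⟨w, ⟨?_, hw⟩, rfl⟩
    rw [← hinvn n]; exact hzA
  have hvol : volume (F^[n] '' (A ∩ Set.Icc x y)) ≤
      ENNReal.ofReal (D * K) * volume (A ∩ Set.Icc x y) := by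
    have h := lintegral_image_eq_lintegral_abs_deriv_mul
      (s := A ∩ Set.Icc x y) (hA.inter measurableSet_Icc)
      (fun z _ => (hG z).hasDerivAt.hasDerivWithinAt) (hmono.injective.injOn) (fun _ => 1)
    simp only [mul_one, setLIntegral_const, one_mul] at h
    rw [h, ← setLIntegral_const]
    apply setLIntegral_mono' (hA.inter measurableSet_Icc)
    intro z hz
    rw [abs_of_pos (hpos n z)]
    exact ENNReal.ofReal_le_ofReal (hdist z hz.2 x hx)
  have hcD : c ≤ D * K * volume.real (A ∩ Set.Icc x y) := by
    refine (hAc (F^[n] x)).trans ?_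
    have := ENNReal.toReal_mono (ENNReal.mul_ne_top ENNReal.ofReal_ne_top hfin)
      ((measure_mono himg).trans hvol)
    rwa [ENNReal.toReal_mul, ENNReal.toReal_ofReal (by positivity)] at this
  rw [div_mul_eq_mul_div, div_le_iff₀ (by positivity)]
  have hv0 : 0 ≤ volume.real (A ∩ Set.Icc x y) := measureReal_nonneg
  calc c * (y - x) ≤ D * K * volume.real (A ∩ Set.Icc x y) * (y - x) :=
        mul_le_mul_of_nonneg_right hcD (by linarith)
    _ = (D * (y - x)) * (K * volume.real (A ∩ Set.Icc x y)) := by ring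
    _ ≤ K * (K * volume.real (A ∩ Set.Icc x y)) :=
        mul_le_mul_of_nonneg_right hlen (by positivity)
    _ = _ := by ring

lemma full {A : Set ℝ} (hA : MeasurableSet A) {C μ : ℝ} (hC : 0 < C) (hμ : 1 < μ)
    (h : ∃ ε : ℝ, 0 < ε ∧ ∀ x, ∀ n : ℕ, ∃ y, x < y ∧ y - x ≤ 1 / (C * μ ^ n) ∧
      ε * (y - x) ≤ volume.real (A ∩ Set.Icc x y)) : volume Aᶜ = 0 := by
  obtain ⟨ε, hε, h⟩ := h
  have hae := IsUnifLocDoublingMeasure.ae_tendsto_measure_inter_div (volume : Measure ℝ) Aᶜ 1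
  rw [← Measure.restrict_eq_zero, ← ae_eq_bot, ← Filter.empty_mem_iff_bot]
  filter_upwards [hae] with x hx
  choose y hxy hy hv using h x
  have hlim : Filter.Tendsto (fun n : ℕ => 1 / (C * μ ^ n)) Filter.atTop (nhds 0) := by
    have h1 : Filter.Tendsto (fun n : ℕ => C * μ ^ n) Filter.atTop Filter.atTop :=
      (tendsto_pow_atTop_atTop_of_one_lt hμ).const_mul_atTop hC
    simp only [one_div]
    exact h1.inv_tendsto_atTop
  have hδ : Filter.Tendsto (fun n => (y n - x) / 2) Filter.atTop (nhdsWithin 0 (Set.Ioi 0)) := by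
    rw [tendsto_nhdsWithin_iff]
    refine ⟨squeeze_zero (fun n => by linarith [hxy n]) (fun n => ?_) hlim,
      Filter.Eventually.of_forall fun n => ?_⟩
    · linarith [hy n, hxy n]
    · simp [hxy n]
  have ht := hx (fun n => (x + y n) / 2) _ hδ (Filter.Eventually.of_forall fun n => by
    rw [Real.closedBall_eq_Icc]; constructor <;> linarith [hxy n])
  have hball : ∀ n, Metric.closedBall ((x + y n) / 2) ((y n - x) / 2) = Set.Icc x (y n) := by
    intro n; rw [Real.closedBall_eq_Icc]; congr 1 <;> ring
  simp only [hball] at ht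
  have ht' := (ENNReal.tendsto_toReal ENNReal.one_ne_top).comp ht
  have hle := le_of_tendsto ht' (b := 1 - ε) (Filter.Eventually.of_forall fun n => by
    have hsum : volume.real (A ∩ Set.Icc x (y n)) + volume.real (Aᶜ ∩ Set.Icc x (y n))
        = y n - x := by
      have := measureReal_inter_add_sdiff (μ := volume) (s := Set.Icc x (y n)) hA (by simp)
      rw [Set.sdiff_eq, Set.inter_comm, Set.inter_comm _ Aᶜ] at this
      rw [this, Real.volume_real_Icc_of_le (hxy n).le]
    simp only [Function.comp, ENNReal.toReal_div]
    change volume.real (Aᶜ ∩ Set.Icc x (y n)) / volume.real (Set.Icc x (y n)) ≤ _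
    rw [Real.volume_real_Icc_of_le (hxy n).le, div_le_iff₀ (by linarith [hxy n])]
    linarith [hv n])
  simp at hle
  linarith

end S5

/-- A `C²` expanding circle map of degree `d ≥ 2` (induced by a `C²` lift `F` with
`F(x+1) = F(x) + d` and `(Fⁿ)'(x) ≥ C μⁿ` for some `C > 0`, `μ > 1`) that preserves the
Haar (Lebesgue) probability measure on `S¹ = ℝ/ℤ` is ergodic with respect to it. -/
theorem stmt5 (d : ℕ) (hd : 2 ≤ d)
    (f : AddCircle (1 : ℝ) → AddCircle (1 : ℝ)) (F : ℝ → ℝ)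
    (hlift : ∀ x : ℝ, f (x : AddCircle (1 : ℝ)) = (F x : AddCircle (1 : ℝ)))
    (hsmooth : ContDiff ℝ 2 F)
    (hdeg : ∀ x : ℝ, F (x + 1) = F x + d)
    (hexp : ∃ C > (0 : ℝ), ∃ μ > (1 : ℝ), ∀ x : ℝ, ∀ n : ℕ,
      C * μ ^ n ≤ deriv (F^[n]) x)
    (hpres : MeasurePreserving f volume volume) :
    Ergodic f volume := by
  obtain ⟨C, hC, μ, hμ, hexp⟩ := hexp
  refine { hpres with aeconst_set := fun s hs hfs => ?_ }
  rw [Filter.eventuallyConst_set']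
  by_cases h0 : volume s = 0
  · left; exact ae_eq_empty.2 h0
  right
  set A : Set ℝ := (fun x : ℝ => (x : AddCircle (1 : ℝ))) ⁻¹' s with hAdef
  have hmp := fun a => AddCircle.measurePreserving_mk (1 : ℝ) a
  have hA : MeasurableSet A := (hmp 0).measurable hs
  have hvol : ∀ t : Set (AddCircle (1:ℝ)), MeasurableSet t → ∀ a,
      volume ((fun x : ℝ => (x : AddCircle (1 : ℝ))) ⁻¹' t ∩ Set.Ioc a (a + 1)) = volume t := by
    intro t ht a
    rw [← (hmp a).measure_preimage ht.nullMeasurableSet,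
      Measure.restrict_apply ((hmp 0).measurable ht)]
  have hinv : F ⁻¹' A = A := by
    ext x
    have : f (x : AddCircle (1:ℝ)) ∈ s ↔ (x : AddCircle (1:ℝ)) ∈ s := by
      rw [← Set.mem_preimage, hfs]
    rw [hlift] at this
    exact this
  have hc : 0 < volume.real s := by
    rw [measureReal_def]
    exact ENNReal.toReal_pos h0 (measure_ne_top _ _)
  have hz := S5.full hA hC hμ (S5.main hsmooth hdeg hC hμ hexp hA hinv hc
    (fun a => by rw [measureReal_def, measureReal_def, hvol s hs a]))
  rw [ae_eq_univ, ← hvol sᶜ hs.compl 0]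
  exact measure_mono_null Set.inter_subset_left hz
end

section
/- Let f : S¹ → S¹ be a C² expanding circle map of degree d ≥ 2. Then there exist an f-invariant Borel probability measure ν on S¹ and a constant c ≥ 1 such that ν is absolutely continuous with respect to λ and its Radon–Nikodym derivative satisfies c⁻¹ ≤ dν/dλ(x) ≤ c for λ-almost every x. In particular, ν and λ are mutually absolutely continuous. -/
open MeasureTheory Filter Topology
open scoped ENNReal

lemma exists_inv_aux {X : Type*} [MeasurableSpace X] (m : Measure X) [IsProbabilityMeasure m]
    (f : X → X) (hf : Measurable f) (c : ℝ≥0∞) (hc : c ≠ ⊤)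
    (h1 : ∀ n : ℕ, ∀ A, MeasurableSet A → m (f^[n] ⁻¹' A) ≤ c * m A)
    (h2 : ∀ n : ℕ, ∀ A, MeasurableSet A → m A ≤ c * m (f^[n] ⁻¹' A)) :
    ∃ ν : Measure X, IsProbabilityMeasure ν ∧
      (∀ A, MeasurableSet A → ν (f ⁻¹' A) = ν A) ∧
      (∀ A, MeasurableSet A → ν A ≤ c * m A) ∧ (∀ A, MeasurableSet A → m A ≤ c * ν A) := by
  classical
  let u : ℕ → Set X → ℝ≥0∞ := fun n A =>
    ((n : ℝ≥0∞) + 1)⁻¹ * ∑ k ∈ Finset.range (n + 1), m (f^[k] ⁻¹' A)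
  have hn0 : ∀ n : ℕ, ((n : ℝ≥0∞) + 1) ≠ 0 := fun n => by simp
  have hnt : ∀ n : ℕ, ((n : ℝ≥0∞) + 1) ≠ ⊤ := fun n => by
    simp [ENNReal.add_eq_top]
  let l : Ultrafilter ℕ := hyperfilter ℕ
  have hl : (l : Filter ℕ) ≤ atTop := by
    have := Nat.hyperfilter_le_atTop
    exact this
  have hex : ∀ A, ∃ a, Tendsto (fun n => u n A) l (𝓝 a) := fun A =>
    ⟨(l.map (fun n => u n A)).lim, (l.map (fun n => u n A)).le_nhds_lim⟩
  choose L hL using hex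
  have hm : ∀ k : ℕ, Measurable (f^[k]) := fun k => hf.iterate k
  have hsum1 : ∀ n : ℕ, ∀ b : ℝ≥0∞,
      ((n : ℝ≥0∞) + 1)⁻¹ * ∑ k ∈ Finset.range (n + 1), b = b := fun n b => by
    rw [Finset.sum_const, Finset.card_range, nsmul_eq_mul, ← mul_assoc]
    push_cast
    rw [ENNReal.inv_mul_cancel (hn0 n) (hnt n), one_mul]
  have hLle : ∀ A, MeasurableSet A → L A ≤ c * m A := fun A hA => by
    refine le_of_tendsto (hL A) (Eventually.of_forall fun n => ?_)
    rw [← hsum1 n (c * m A)]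
    exact mul_le_mul_right (Finset.sum_le_sum fun k _ => h1 k A hA) _
  have hleL : ∀ A, MeasurableSet A → m A ≤ c * L A := fun A hA => by
    refine ge_of_tendsto (ENNReal.Tendsto.const_mul (hL A) (Or.inr hc))
      (Eventually.of_forall fun n => ?_)
    rw [← hsum1 n (m A)]
    simp only [u]
    rw [mul_left_comm, Finset.mul_sum _ _ c]
    exact mul_le_mul_right (Finset.sum_le_sum fun k _ => h2 k A hA) _
  have hLuniv : L Set.univ = 1 := by
    refine tendsto_nhds_unique (hL _) ?_
    have : (fun n => u n Set.univ) = fun _ => 1 := by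
      funext n
      simp only [u, Set.preimage_univ, measure_univ]
      exact hsum1 n 1
    rw [this]; exact tendsto_const_nhds
  have hLempty : L ∅ = 0 := by
    have := hLle ∅ MeasurableSet.empty
    simpa using this
  have hLadd : ∀ A B, MeasurableSet A → MeasurableSet B → Disjoint A B →
      L (A ∪ B) = L A + L B := fun A B hA hB hAB => by
    refine tendsto_nhds_unique (hL _) ?_
    have : (fun n => u n (A ∪ B)) = fun n => u n A + u n B := by
      funext n
      simp only [u]
      rw [← mul_add, ← Finset.sum_add_distrib]
      congr 1
      refine Finset.sum_congr rfl fun k _ => ?_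
      rw [Set.preimage_union, measure_union (hAB.preimage _) (hm k hB)]
    rw [this]; exact (hL A).add (hL B)
  have hLinv : ∀ A, MeasurableSet A → L (f ⁻¹' A) = L A := fun A hA => by
    have hz : ∀ b : ℕ → ℝ≥0∞, (∀ n, b n ≤ 1) →
        Tendsto (fun n : ℕ => ((n : ℝ≥0∞) + 1)⁻¹ * b n) l (𝓝 0) := fun b hb => by
      refine Tendsto.mono_left ?_ hl
      have h0 : Tendsto (fun n : ℕ => ((n : ℝ≥0∞) + 1)⁻¹) atTop (𝓝 0) := by
        have := (tendsto_add_atTop_iff_nat 1).2 ENNReal.tendsto_inv_nat_nhds_zero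
        simpa using this
      refine tendsto_of_tendsto_of_tendsto_of_le_of_le tendsto_const_nhds h0
        (fun _ => zero_le) (fun n => ?_)
      exact mul_le_of_le_one_right' (hb n)
    have e : ∀ n, u n (f ⁻¹' A) + ((n : ℝ≥0∞) + 1)⁻¹ * m A =
        u n A + ((n : ℝ≥0∞) + 1)⁻¹ * m (f^[n+1] ⁻¹' A) := fun n => by
      simp only [u]
      rw [← mul_add, ← mul_add]
      congr 1
      rw [← Finset.sum_range_succ (fun k => m (f^[k] ⁻¹' A)), Finset.sum_range_succ' _ (n + 1)]
      simp only [Function.iterate_succ', Set.preimage_comp, Function.iterate_zero, Set.preimage_id]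
    have t1 := (hL (f ⁻¹' A)).add (hz (fun _ => m A) (fun _ => prob_le_one))
    have t2 := (hL A).add (hz (fun n => m (f^[n+1] ⁻¹' A)) (fun _ => prob_le_one))
    simp only [e] at t1
    simpa using tendsto_nhds_unique t1 t2
  have hLfin : ∀ (g : ℕ → Set X), (∀ i, MeasurableSet (g i)) → Pairwise (Function.onFun Disjoint g) →
      ∀ n, L (⋃ i, g i) = ∑ i ∈ Finset.range n, L (g i) + L (⋃ i, g (i + n)) := by
    intro g hg hd n
    induction n with
    | zero => simp
    | succ n ih =>
      rw [ih, Finset.sum_range_succ, add_assoc]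
      congr 1
      rw [← hLadd _ _ (hg n) (MeasurableSet.iUnion fun i => hg _)]
      · congr 1
        ext x
        simp only [Set.mem_iUnion, Set.mem_union]
        constructor
        · rintro ⟨i, hi⟩
          cases i with
          | zero => left; simpa using hi
          | succ i => right; exact ⟨i, by rwa [show i + (n+1) = i + 1 + n by ring]⟩
        · rintro (h | ⟨i, hi⟩)
          · exact ⟨0, by simpa using h⟩
          · exact ⟨i + 1, by rwa [show i + 1 + n = i + (n+1) by ring]⟩
      · rw [Set.disjoint_iUnion_right]
        intro i
        exact hd (by omega)
  have hLsig : ∀ (g : ℕ → Set X), (∀ i, MeasurableSet (g i)) → Pairwise (Function.onFun Disjoint g) →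
      L (⋃ i, g i) = ∑' i, L (g i) := by
    intro g hg hd
    have ht : Tendsto (fun n => L (⋃ i, g (i + n))) atTop (𝓝 0) := by
      have hs : ∑' i, m (g i) ≠ ⊤ := by
        rw [← measure_iUnion hd hg]; exact measure_ne_top _ _
      have t0 := ENNReal.tendsto_sum_nat_add (fun i => m (g i)) hs
      have t1 := ENNReal.Tendsto.const_mul (a := c) t0 (Or.inr hc)
      rw [mul_zero] at t1
      refine tendsto_of_tendsto_of_tendsto_of_le_of_le tendsto_const_nhds t1
        (fun _ => zero_le) (fun n => ?_)
      refine (hLle _ (MeasurableSet.iUnion fun i => hg _)).trans ?_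
      exact mul_le_mul_right (measure_iUnion_le _) _
    have t2 := (ENNReal.tendsto_nat_tsum (fun i => L (g i))).add ht
    simp only [← hLfin g hg hd, add_zero] at t2
    exact tendsto_nhds_unique tendsto_const_nhds t2
  refine ⟨Measure.ofMeasurable (fun A _ => L A) hLempty (fun g hg hd => hLsig g hg hd), ?_, ?_, ?_, ?_⟩
  · constructor
    rw [Measure.ofMeasurable_apply _ MeasurableSet.univ, hLuniv]
  · intro A hA
    rw [Measure.ofMeasurable_apply _ hA, Measure.ofMeasurable_apply _ (hf hA), hLinv A hA]
  · intro A hA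
    rw [Measure.ofMeasurable_apply _ hA]; exact hLle A hA
  · intro A hA
    rw [Measure.ofMeasurable_apply _ hA]; exact hleL A hA

lemma rn_aux {X : Type*} [MeasurableSpace X] (m ν : Measure X) [IsProbabilityMeasure m]
    [IsProbabilityMeasure ν] (c : NNReal) (hc : 1 ≤ c)
    (h1 : ∀ A, MeasurableSet A → ν A ≤ c * m A) (h2 : ∀ A, MeasurableSet A → m A ≤ c * ν A) :
    ν ≪ m ∧ m ≪ ν ∧ ∀ᵐ x ∂m, (c : ℝ≥0∞)⁻¹ ≤ ν.rnDeriv m x ∧ ν.rnDeriv m x ≤ c := by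
  have a1 : ν ≪ m := Measure.AbsolutelyContinuous.mk fun s hs h => by
    have := h1 s hs
    simpa [h] using this
  have a2 : m ≪ ν := Measure.AbsolutelyContinuous.mk fun s hs h => by
    have := h2 s hs
    simpa [h] using this
  refine ⟨a1, a2, ?_⟩
  have hc0 : (c : ℝ≥0∞) ≠ 0 := by
    have : c ≠ 0 := (lt_of_lt_of_le one_pos hc).ne'
    exact_mod_cast this
  have b1 : (fun _ => (c : ℝ≥0∞)⁻¹) ≤ᵐ[m] ν.rnDeriv m := by
    refine ae_le_of_forall_setLIntegral_le_of_sigmaFinite measurable_const fun s hs _ => ?_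
    rw [setLIntegral_const, Measure.setLIntegral_rnDeriv a1]
    calc (c : ℝ≥0∞)⁻¹ * m s ≤ (c : ℝ≥0∞)⁻¹ * (c * ν s) := mul_le_mul_right (h2 s hs) _
      _ = ν s := by rw [← mul_assoc, ENNReal.inv_mul_cancel hc0 ENNReal.coe_ne_top, one_mul]
  have b2 : ν.rnDeriv m ≤ᵐ[m] (fun _ => (c : ℝ≥0∞)) := by
    refine ae_le_of_forall_setLIntegral_le_of_sigmaFinite (Measure.measurable_rnDeriv _ _) fun s hs _ => ?_
    rw [setLIntegral_const, Measure.setLIntegral_rnDeriv a1]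
    exact h1 s hs
  filter_upwards [b1, b2] with x hx1 hx2 using ⟨hx1, hx2⟩

lemma distortion_aux (d : ℕ) (F : ℝ → ℝ) (hs : ContDiff ℝ 2 F)
    (hdeg : ∀ x : ℝ, F (x + 1) = F x + d) (C μ : ℝ) (hC : 0 < C) (hμ : 1 < μ)
    (hexp : ∀ x : ℝ, ∀ n : ℕ, C * μ ^ n ≤ deriv (F^[n]) x) :
    ∃ K : ℝ, 1 ≤ K ∧ ∀ n x y, |F^[n] x - F^[n] y| ≤ 1 →
      deriv (F^[n]) x ≤ K * deriv (F^[n]) y := by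
  have hdF : Differentiable ℝ F := hs.differentiable (by norm_num)
  have hdn : ∀ n, Differentiable ℝ (F^[n]) := fun n => hdF.iterate n
  have hposn : ∀ n x, 0 < deriv (F^[n]) x := fun n x => lt_of_lt_of_le (by positivity) (hexp x n)
  have hpos : ∀ x, 0 < deriv F x := fun x => by simpa using hposn 1 x
  have hd1 : ContDiff ℝ 1 (deriv F) := by
    have : ContDiff ℝ (1 + 1) F := by
      convert hs using 1; norm_num
    exact (contDiff_succ_iff_deriv.1 this).2.2
  have hφ1 : ContDiff ℝ 1 (fun x => Real.log (deriv F x)) := hd1.log (fun x => (hpos x).ne')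
  have hper1 : ∀ x, deriv F (x + 1) = deriv F x := fun x => by
    rw [← deriv_comp_add_const]
    simp only [hdeg, deriv_add_const]
  have hper2 : Function.Periodic (deriv (fun x => Real.log (deriv F x))) 1 := fun x => by
    rw [← deriv_comp_add_const]
    simp only [hper1]
  obtain ⟨M, hM⟩ := (hper2.isBounded_of_continuous one_ne_zero
    (hφ1.continuous_deriv le_rfl)).exists_norm_le
  have hM0 : 0 ≤ M := (norm_nonneg _).trans (hM _ ⟨0, rfl⟩)
  have hLip : ∀ x y, |Real.log (deriv F x) - Real.log (deriv F y)| ≤ M * |x - y| := fun x y => by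
    have := Convex.norm_image_sub_le_of_norm_deriv_le (f := fun x => Real.log (deriv F x))
      (C := M) (s := Set.univ) (x := y) (y := x)
      (fun z _ => (hφ1.differentiable one_ne_zero) z) (fun z _ => hM _ ⟨z, rfl⟩) convex_univ
      trivial trivial
    simpa [Real.norm_eq_abs] using this
  have hlog : ∀ n x, Real.log (deriv (F^[n]) x) =
      ∑ k ∈ Finset.range n, Real.log (deriv F (F^[k] x)) := fun n x => by
    induction n with
    | zero => simp
    | succ n ih =>
      rw [Finset.sum_range_succ, ← ih, Function.iterate_succ',
        deriv_comp x (hdF _) (hdn n x), Real.log_mul (hpos _).ne' (hposn n x).ne', add_comm]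
  have hexpand : ∀ n x y, C * μ ^ n * |x - y| ≤ |F^[n] x - F^[n] y| := by
    have key : ∀ n x y, x ≤ y → C * μ ^ n * |x - y| ≤ |F^[n] x - F^[n] y| := fun n x y hxy => by
      have := mul_sub_le_image_sub_of_le_deriv (hdn n) (fun z => hexp z n) hxy
      rw [abs_sub_comm x y, abs_sub_comm (F^[n] x), abs_of_nonneg (sub_nonneg.2 hxy)]
      exact this.trans (le_abs_self _)
    intro n x y
    rcases le_total x y with h | h
    · exact key n x y h
    · rw [abs_sub_comm x y, abs_sub_comm (F^[n] x)]; exact key n y x h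
  have hμ0 : 0 < μ := by linarith
  have hq0 : 0 ≤ μ⁻¹ := by positivity
  have hq1 : μ⁻¹ < 1 := inv_lt_one_of_one_lt₀ hμ
  refine ⟨Real.exp (M * C⁻¹ * (1 - μ⁻¹)⁻¹), ?_, ?_⟩
  · apply Real.one_le_exp
    have : 0 < 1 - μ⁻¹ := by linarith
    positivity
  intro n x y hxy
  have hdiff : Real.log (deriv (F^[n]) x) - Real.log (deriv (F^[n]) y) ≤
      M * C⁻¹ * (1 - μ⁻¹)⁻¹ := by
    rw [hlog, hlog, ← Finset.sum_sub_distrib]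
    have hb : ∀ k ∈ Finset.range n, Real.log (deriv F (F^[k] x)) - Real.log (deriv F (F^[k] y))
        ≤ M * C⁻¹ * (μ⁻¹) ^ (n - 1 - k) := fun k hk => by
      have hk' : k < n := Finset.mem_range.1 hk
      refine (le_abs_self _).trans ((hLip _ _).trans ?_)
      rw [mul_assoc]
      refine mul_le_mul_of_nonneg_left ?_ hM0
      have h := hexpand (n - k) (F^[k] x) (F^[k] y)
      rw [← Function.iterate_add_apply, ← Function.iterate_add_apply,
        Nat.sub_add_cancel hk'.le] at h
      have h3 : C * μ ^ (n - 1 - k) * |F^[k] x - F^[k] y| ≤ 1 := by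
        refine le_trans ?_ (h.trans hxy)
        gcongr
        · exact hμ.le
        · omega
      rw [inv_pow, ← mul_inv, ← one_div, le_div_iff₀ (by positivity), mul_comm]
      exact h3
    refine (Finset.sum_le_sum hb).trans ?_
    rw [← Finset.mul_sum, Finset.sum_range_reflect (fun j => (μ⁻¹) ^ j)]
    have : 0 ≤ M * C⁻¹ := by positivity
    refine mul_le_mul_of_nonneg_left ?_ this
    rw [← tsum_geometric_of_lt_one hq0 hq1]
    exact (summable_geometric_of_lt_one hq0 hq1).sum_le_tsum _ (fun i _ => by positivity)
  have h4 : Real.log (deriv (F^[n]) x) ≤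
     M * C⁻¹ * (1 - μ⁻¹)⁻¹ +  Real.log (deriv (F^[n]) y) := by linarith
  have h5 := Real.exp_le_exp.2 h4
  rwa [Real.exp_add, Real.exp_log (hposn n x), Real.exp_log (hposn n y)] at h5

/-- one branch -/
lemma branch_aux (G : ℝ → ℝ) (hG : ContDiff ℝ 1 G) (hpos : ∀ x, 0 < deriv G x)
    (hsurj : Function.Surjective G) (K : NNReal)
    (hK : ∀ x y, |G x - G y| ≤ 1 → deriv G x ≤ K * deriv G y) (a : ℝ)
    (B : Set ℝ) (hB : MeasurableSet B) (hBs : B ⊆ Set.Ioc a (a + 1)) :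
    volume (G ⁻¹' B) ≤ (K ^ 2 : NNReal) * (volume (G ⁻¹' (Set.Ioc a (a + 1))) * volume B) ∧
    volume (G ⁻¹' (Set.Ioc a (a + 1))) * volume B ≤ (K ^ 2 : NNReal) * volume (G ⁻¹' B) := by
  have hmono : StrictMono G := strictMono_of_deriv_pos hpos
  have hdiff : Differentiable ℝ G := hG.differentiable one_ne_zero
  have hvol : ∀ s, MeasurableSet s → volume s = ∫⁻ x in G ⁻¹' s, ENNReal.ofReal (deriv G x) := by
    intro s hs
    have := lintegral_image_eq_lintegral_abs_deriv_mul (s := G ⁻¹' s) (f := G) (f' := deriv G)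
      (hG.continuous.measurable hs) (fun x _ => (hdiff x).hasDerivAt.hasDerivWithinAt)
      hmono.injective.injOn (fun _ => 1)
    rw [Set.image_preimage_eq _ hsurj] at this
    simp only [mul_one, lintegral_const, MeasurableSet.univ, Measure.restrict_apply, Set.univ_inter,
      one_mul] at this
    rw [this]
    refine lintegral_congr fun x => by rw [abs_of_pos (hpos x)]
  obtain ⟨p, hp⟩ := hsurj (a + 1)
  set m : ℝ≥0∞ := ENNReal.ofReal (deriv G p) with hm
  have hm0 : m ≠ 0 := by simpa [hm] using hpos p
  have hmt : m ≠ ⊤ := ENNReal.ofReal_ne_top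
  have hup : ∀ s, MeasurableSet s → s ⊆ Set.Ioc a (a+1) → volume s ≤ K * m * volume (G ⁻¹' s) := by
    intro s hs hsub
    rw [hvol s hs, ← setLIntegral_const]
    refine setLIntegral_mono measurable_const fun x hx => ?_
    have hx' := hsub hx
    rw [hm, ← ENNReal.ofReal_coe_nnreal, ← ENNReal.ofReal_mul (NNReal.coe_nonneg K)]
    refine ENNReal.ofReal_le_ofReal (hK x p ?_)
    rw [hp, abs_le]; constructor <;> linarith [hx'.1, hx'.2]
  have hlow : ∀ s, MeasurableSet s → s ⊆ Set.Ioc a (a+1) → m * volume (G ⁻¹' s) ≤ K * volume s := by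
    intro s hs hsub
    rw [hvol s hs, ← setLIntegral_const, ← lintegral_const_mul' _ _ ENNReal.coe_ne_top]
    refine setLIntegral_mono (by
      have := hG.continuous_deriv le_rfl
      exact (this.measurable.ennreal_ofReal).const_mul _) fun x hx => ?_
    have hx' := hsub hx
    rw [hm, ← ENNReal.ofReal_coe_nnreal, ← ENNReal.ofReal_mul (NNReal.coe_nonneg K)]
    refine ENNReal.ofReal_le_ofReal (hK p x ?_)
    rw [hp, abs_le]; constructor <;> linarith [hx'.1, hx'.2]
  have hJ : volume (Set.Ioc a (a+1)) = 1 := by simp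
  have u1 := hup B hB hBs
  have l1 := hlow B hB hBs
  have u2 := hup _ measurableSet_Ioc (le_refl (Set.Ioc a (a+1)))
  have l2 := hlow _ measurableSet_Ioc (le_refl (Set.Ioc a (a+1)))
  rw [hJ] at u2 l2
  set I := volume (G ⁻¹' (Set.Ioc a (a + 1)))
  push_cast
  constructor
  · rw [← ENNReal.mul_le_mul_iff_right hm0 hmt]
    calc m * volume (G ⁻¹' B) ≤ K * volume B * 1 := by rw [mul_one]; exact l1
      _ ≤ K * volume B * (K * m * I) := mul_le_mul_right u2 _
      _ = _ := by ring
  · rw [← ENNReal.mul_le_mul_iff_right hm0 hmt]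
    calc m * (I * volume B) = m * I * volume B := by ring
      _ ≤ K * 1 * (K * m * volume (G ⁻¹' B)) := mul_le_mul' l2 u1
      _ = _ := by ring

lemma circle_aux (N : ℕ) (G : ℝ → ℝ) (hG : ContDiff ℝ 1 G) (hpos : ∀ x, 0 < deriv G x)
    (hsurj : Function.Surjective G) (K : NNReal)
    (hK : ∀ x y, |G x - G y| ≤ 1 → deriv G x ≤ K * deriv G y)
    (hdeg : ∀ x, G (x + 1) = G x + N) (g : AddCircle (1 : ℝ) → AddCircle (1 : ℝ))
    (hg : Measurable g)
    (hlift : ∀ x : ℝ, g (x : AddCircle (1 : ℝ)) = (G x : AddCircle (1 : ℝ)))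
    (A : Set (AddCircle (1 : ℝ))) (hA : MeasurableSet A) :
    volume (g ⁻¹' A) ≤ (K ^ 2 : NNReal) * volume A ∧
    volume A ≤ (K ^ 2 : NNReal) * volume (g ⁻¹' A) := by
  have hmono : StrictMono G := strictMono_of_deriv_pos hpos
  let π : ℝ → AddCircle (1 : ℝ) := fun x => (x : AddCircle (1 : ℝ))
  have hπ : Measurable π := AddCircle.measurable_mk'
  have hvol : ∀ (a : ℝ) (S : Set (AddCircle (1 : ℝ))), MeasurableSet S →
      volume S = volume (π ⁻¹' S ∩ Set.Ioc a (a + 1)) := fun a S hS => by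
    rw [← (AddCircle.measurePreserving_mk 1 a).measure_preimage hS.nullMeasurableSet,
      Measure.restrict_apply (hπ hS)]
  obtain ⟨x0, hx0⟩ := hsurj 0
  have hIoc : Set.Ioc x0 (x0 + 1) = ⋃ j ∈ Finset.range N, G ⁻¹' Set.Ioc (j : ℝ) (j + 1) := by
    ext x
    simp only [Set.mem_iUnion, Finset.mem_range, Set.mem_preimage, Set.mem_Ioc, exists_prop]
    have e1 : x0 < x ↔ 0 < G x := by rw [← hx0, hmono.lt_iff_lt]
    have e2 : x ≤ x0 + 1 ↔ G x ≤ N := by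
      rw [← hmono.le_iff_le, hdeg, hx0, zero_add]
    rw [e1, e2]
    constructor
    · rintro ⟨h1, h2⟩
      have hc : 0 < ⌈G x⌉₊ := Nat.ceil_pos.2 h1
      have hcN : ⌈G x⌉₊ ≤ N := Nat.ceil_le.2 h2
      refine ⟨⌈G x⌉₊ - 1, by omega, ?_, ?_⟩
      · apply Nat.lt_ceil.1; omega
      · have : (((⌈G x⌉₊ - 1 : ℕ) : ℝ) + 1) = ⌈G x⌉₊ := by
          exact_mod_cast Nat.sub_add_cancel hc
        rw [this]; exact Nat.le_ceil _
    · rintro ⟨j, hj, h1, h2⟩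
      refine ⟨lt_of_le_of_lt (Nat.cast_nonneg j) h1, h2.trans ?_⟩
      exact_mod_cast hj
  have hdisj : ∀ T : Set ℝ, Set.PairwiseDisjoint (Finset.range N : Set ℕ)
      (fun j : ℕ => G ⁻¹' (T ∩ Set.Ioc (j : ℝ) (j + 1))) := by
    intro T i _ j _ hij
    refine Disjoint.preimage _ ?_
    rw [Set.disjoint_left]
    rintro x ⟨_, h1, h2⟩ ⟨_, h3, h4⟩
    apply hij
    have a1 : (i : ℝ) < j + 1 := by linarith
    have a2 : (j : ℝ) < i + 1 := by linarith
    have a1' : i < j + 1 := by exact_mod_cast a1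
    have a2' : j < i + 1 := by exact_mod_cast a2
    omega
  have hsum : ∀ S : Set (AddCircle (1 : ℝ)), MeasurableSet S → volume (g ⁻¹' S) =
      ∑ j ∈ Finset.range N, volume (G ⁻¹' (π ⁻¹' S ∩ Set.Ioc (j : ℝ) (j + 1))) := fun S hS => by
    rw [hvol x0 _ (hg hS), hIoc, ← measure_biUnion_finset (hdisj _)
      (fun j _ => hG.continuous.measurable ((hπ hS).inter measurableSet_Ioc))]
    congr 1
    ext x
    simp only [Set.mem_iUnion, Set.mem_inter_iff, Set.mem_preimage, π, hlift, exists_prop]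
    tauto
  have hone : ∑ j ∈ Finset.range N, volume (G ⁻¹' (Set.Ioc (j : ℝ) (j + 1))) = 1 := by
    have := hsum Set.univ MeasurableSet.univ
    simp only [Set.preimage_univ, Set.univ_inter] at this
    rw [← this]
    simp
  have hbr := fun j : ℕ => branch_aux G hG hpos hsurj K hK (j : ℝ)
    (π ⁻¹' A ∩ Set.Ioc (j : ℝ) (j + 1)) ((hπ hA).inter measurableSet_Ioc) Set.inter_subset_right
  simp only [← hvol _ A hA] at hbr
  rw [hsum A hA]
  constructor
  · calc _ ≤ _ := Finset.sum_le_sum fun j _ => (hbr j).1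
      _ = _ := by rw [← Finset.mul_sum, ← Finset.sum_mul, hone, one_mul]
  · calc volume A = ∑ j ∈ Finset.range N, volume (G ⁻¹' (Set.Ioc (j : ℝ) (j + 1))) * volume A := by
          rw [← Finset.sum_mul, hone, one_mul]
      _ ≤ _ := Finset.sum_le_sum fun j _ => (hbr j).2
      _ = _ := by rw [← Finset.mul_sum]

/-- A `C²` expanding circle map of degree `d ≥ 2` admits an invariant Borel probability
measure `ν` that is absolutely continuous with respect to the Haar (Lebesgue) measure
`λ`, whose Radon–Nikodym derivative `dν/dλ` is λ-a.e. bounded between `c⁻¹` and `c` for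
some constant `c ≥ 1`; in particular `ν` and `λ` are mutually absolutely continuous. -/
theorem stmt6 (d : ℕ) (hd : 2 ≤ d)
    (f : AddCircle (1 : ℝ) → AddCircle (1 : ℝ)) (F : ℝ → ℝ)
    (hlift : ∀ x : ℝ, f (x : AddCircle (1 : ℝ)) = (F x : AddCircle (1 : ℝ)))
    (hsmooth : ContDiff ℝ 2 F)
    (hdeg : ∀ x : ℝ, F (x + 1) = F x + d)
    (hexp : ∃ C > (0 : ℝ), ∃ μ > (1 : ℝ), ∀ x : ℝ, ∀ n : ℕ,
      C * μ ^ n ≤ deriv (F^[n]) x) :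
    ∃ ν : Measure (AddCircle (1 : ℝ)), IsProbabilityMeasure ν ∧
      (∀ A : Set (AddCircle (1 : ℝ)), MeasurableSet A → ν (f ⁻¹' A) = ν A) ∧
      ν ≪ volume ∧ volume ≪ ν ∧
      ∃ c : NNReal, 1 ≤ c ∧
        ∀ᵐ x ∂(volume : Measure (AddCircle (1 : ℝ))),
          (c : ENNReal)⁻¹ ≤ ν.rnDeriv volume x ∧ ν.rnDeriv volume x ≤ (c : ENNReal) := by
  obtain ⟨C, hC, μ, hμ, hexp⟩ := hexp
  obtain ⟨K, hK1, hK⟩ := distortion_aux d F hsmooth hdeg C μ hC hμ hexp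
  lift K to NNReal using by linarith
  have hK1' : (1 : NNReal) ≤ K := by exact_mod_cast hK1
  have hfc : Continuous f := by
    have hq : Topology.IsQuotientMap (fun x : ℝ => (x : AddCircle (1 : ℝ))) :=
      isQuotientMap_quotient_mk'
    rw [hq.continuous_iff]
    have : f ∘ (fun x : ℝ => (x : AddCircle (1 : ℝ))) = fun x => (F x : AddCircle (1 : ℝ)) :=
      funext hlift
    rw [this]
    exact (AddCircle.continuous_mk' 1).comp hsmooth.continuous
  have hfm : Measurable f := hfc.measurable
  have hposn : ∀ n x, 0 < deriv (F^[n]) x := fun n x =>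
    lt_of_lt_of_le (by positivity) (hexp x n)
  have hdF : Differentiable ℝ F := hsmooth.differentiable (by norm_num)
  have hsurj : Function.Surjective F := by
    have hlo : ∀ ⦃x y : ℝ⦄, x ≤ y → C * μ * (y - x) ≤ F y - F x :=
      mul_sub_le_image_sub_of_le_deriv hdF (fun z => by simpa using hexp z 1)
    have ha : 0 < C * μ := by positivity
    refine hsmooth.continuous.surjective ?_ ?_
    · refine tendsto_atTop_mono' atTop ?_
        (tendsto_atTop_add_const_right atTop (F 0) (tendsto_id.const_mul_atTop ha))
      filter_upwards [eventually_ge_atTop 0] with x hx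
      have := hlo hx
      simp only [id]; linarith
    · refine tendsto_atBot_mono' atBot ?_
        (tendsto_atBot_add_const_right atBot (F 0) (tendsto_id.const_mul_atBot ha))
      filter_upwards [eventually_le_atBot 0] with x hx
      have := hlo hx
      simp only [id]; linarith
  have hdegm : ∀ m : ℕ, ∀ x, F (x + m) = F x + m * d := fun m => by
    induction m with
    | zero => simp
    | succ m ih =>
      intro x
      push_cast
      rw [← add_assoc, hdeg, ih]; ring
  have hdegn : ∀ n : ℕ, ∀ x, F^[n] (x + 1) = F^[n] x + (d ^ n : ℕ) := fun n => by
    induction n with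
    | zero => simp
    | succ n ih =>
      intro x
      rw [Function.iterate_succ_apply', ih, hdegm, Function.iterate_succ_apply']
      push_cast; ring
  have hliftn : ∀ n : ℕ, ∀ x : ℝ,
      f^[n] (x : AddCircle (1 : ℝ)) = (F^[n] x : AddCircle (1 : ℝ)) := fun n => by
    induction n with
    | zero => simp
    | succ n ih =>
      intro x
      rw [Function.iterate_succ_apply', ih, hlift, Function.iterate_succ_apply']
  have hsm : ∀ n, ContDiff ℝ 1 (F^[n]) := fun n => by
    have h1 : ContDiff ℝ 1 F := hsmooth.of_le (by norm_num)
    induction n with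
    | zero => exact contDiff_id
    | succ n ih =>
      rw [Function.iterate_succ']
      exact h1.comp ih
  have hb := fun n : ℕ => circle_aux (d ^ n) (F^[n]) (hsm n) (hposn n) (hsurj.iterate n) K
    (hK n) (hdegn n) (f^[n]) (hfm.iterate n) (hliftn n)
  have : IsProbabilityMeasure (volume : Measure (AddCircle (1 : ℝ))) := ⟨by simp⟩
  obtain ⟨ν, hν, hinv, h1, h2⟩ := exists_inv_aux (volume : Measure (AddCircle (1 : ℝ))) f hfm
    ((K ^ 2 : NNReal) : ℝ≥0∞) ENNReal.coe_ne_top (fun n A hA => (hb n A hA).1)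
    (fun n A hA => (hb n A hA).2)
  have hc : (1 : NNReal) ≤ K ^ 2 := one_le_pow₀ hK1'
  obtain ⟨r1, r2, r3⟩ := rn_aux volume ν (K ^ 2) hc h1 h2
  exact ⟨ν, hν, hinv, r1, r2, K ^ 2, hc, r3⟩
end

section
/- Let f : S¹ → S¹ be a C² expanding circle map of degree d ≥ 2. Then there exists a constant c ≥ 1 such that for every n ≥ 1, the push-forward measure fⁿ_*λ is absolutely continuous with respect to λ and its Radon–Nikodym derivative ρ_n = d(fⁿ_*λ)/dλ satisfies c⁻¹ ≤ ρ_n(x) ≤ c for λ-almost every x ∈ S¹. -/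
open MeasureTheory

lemma distortion (F : ℝ → ℝ) (d : ℕ)
    (hsmooth : ContDiff ℝ 2 F)
    (hdeg : ∀ x : ℝ, F (x + 1) = F x + d)
    (C : ℝ) (hC : 0 < C) (μ : ℝ) (hμ : 1 < μ) (hexp : ∀ x : ℝ, ∀ n : ℕ,
      C * μ ^ n ≤ deriv (F^[n]) x) :
    ∃ M : ℝ, 0 ≤ M ∧ ∀ n x y, |Real.log (deriv (F^[n]) x) - Real.log (deriv (F^[n]) y)|
      ≤ M * |F^[n] x - F^[n] y| := by
  have hFd : Differentiable ℝ F := hsmooth.differentiable (by norm_num)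
  have hF1 : ContDiff ℝ 1 (deriv F) := by
    have : ContDiff ℝ (1+1) F := by simpa [one_add_one_eq_two] using hsmooth
    exact (contDiff_succ_iff_deriv.1 this).2.2
  have hit : ∀ n, Differentiable ℝ (F^[n]) := fun n => hFd.iterate n
  have hpos : ∀ n x, 0 < deriv (F^[n]) x := fun n x =>
    lt_of_lt_of_le (by positivity) (hexp x n)
  have hpos1 : ∀ x, 0 < deriv F x := fun x => by simpa using hpos 1 x
  have hper : Function.Periodic (deriv F) 1 := by
    intro x
    have : (fun y => F (y + 1)) = fun y => F y + d := funext hdeg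
    rw [← deriv_comp_add_const, this, deriv_add_const]
  have hg : ContDiff ℝ 1 (fun x => Real.log (deriv F x)) :=
    hF1.log (fun x => (hpos1 x).ne')
  have hgper : Function.Periodic (deriv (fun x => Real.log (deriv F x))) 1 := by
    intro x
    rw [← deriv_comp_add_const]
    simp only [hper _]
  have hbd := hgper.isBounded_of_continuous one_ne_zero (hg.continuous_deriv le_rfl)
  obtain ⟨L, hL⟩ := hbd.exists_norm_le
  have hL' : ∀ x, ‖deriv (fun x => Real.log (deriv F x)) x‖ ≤ L := fun x => hL _ ⟨x, rfl⟩
  have hL0 : 0 ≤ L := (norm_nonneg _).trans (hL' 0)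
  have hlip : ∀ x y, |Real.log (deriv F x) - Real.log (deriv F y)| ≤ L * |x - y| := fun x y =>
    Convex.norm_image_sub_le_of_norm_deriv_le (f := fun x => Real.log (deriv F x)) (s := Set.univ)
      (fun x _ => (hg.differentiable one_ne_zero) x) (fun x _ => hL' x) convex_univ trivial trivial
  have hexpand : ∀ n x y, C * μ^n * |x - y| ≤ |F^[n] x - F^[n] y| := by
    intro n x y
    wlog h : y ≤ x generalizing x y
    · rw [abs_sub_comm, abs_sub_comm (F^[n] x)]; exact this y x (le_of_not_ge h)
    rw [abs_of_nonneg (sub_nonneg.2 h)]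
    exact (mul_sub_le_image_sub_of_le_deriv (hit n) (fun x => hexp x n) h).trans (le_abs_self _)
  have hμ0 : 0 < μ := by linarith
  have hμ1 : 0 < μ - 1 := by linarith
  refine ⟨L * C⁻¹ / (μ - 1), by positivity, ?_⟩
  have key : ∀ n x y, |Real.log (deriv (F^[n]) x) - Real.log (deriv (F^[n]) y)|
      ≤ L * C⁻¹ / (μ - 1) * (1 - (μ ^ n)⁻¹) * |F^[n] x - F^[n] y| := by
    intro n
    induction n with
    | zero => intro x y; simp
    | succ n ih =>
      intro x y
      have hd : ∀ z, Real.log (deriv (F^[n+1]) z)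
          = Real.log (deriv (F^[n]) (F z)) + Real.log (deriv F z) := by
        intro z
        rw [Function.iterate_succ, deriv_comp z (hit n _) (hFd z),
          Real.log_mul (hpos n _).ne' (hpos1 z).ne']
      rw [hd, hd]
      have h1 := ih (F x) (F y)
      have h2 := hlip x y
      have h3 := hexpand (n+1) x y
      rw [Function.iterate_succ_apply, Function.iterate_succ_apply] at h3 ⊢
      set Δ := |F^[n] (F x) - F^[n] (F y)|
      have h4 : |x - y| ≤ C⁻¹ * (μ^(n+1))⁻¹ * Δ := by
        rw [← mul_inv, ← div_eq_inv_mul, le_div_iff₀ (by positivity)]; linarith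
      have h5 : L * |x - y| ≤ L * (C⁻¹ * (μ^(n+1))⁻¹ * Δ) := by gcongr
      have h6 : L * C⁻¹ / (μ - 1) * (1 - (μ ^ (n+1))⁻¹) * Δ =
          L * C⁻¹ / (μ - 1) * (1 - (μ ^ n)⁻¹) * Δ + L * (C⁻¹ * (μ^(n+1))⁻¹ * Δ) := by
        rw [pow_succ]; field_simp; ring
      rw [h6]
      have h7 := abs_add_le (Real.log (deriv (F^[n]) (F x)) - Real.log (deriv (F^[n]) (F y)))
        (Real.log (deriv F x) - Real.log (deriv F y))
      rw [add_sub_add_comm]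
      linarith
  intro n x y
  refine (key n x y).trans ?_
  have : 0 ≤ (μ^n)⁻¹ := by positivity
  gcongr
  apply mul_le_of_le_one_right (by positivity) (by linarith)

lemma vol_pair (G : ℝ → ℝ) (hG : Differentiable ℝ G) (hm : Monotone G)
    (K : ENNReal) (S T : Set ℝ) (hS : MeasurableSet S) (hT : MeasurableSet T)
    (hK : ∀ x ∈ S, ∀ y ∈ T, ENNReal.ofReal (deriv G x) ≤ K * ENNReal.ofReal (deriv G y)) :
    volume (G '' S) * volume T ≤ K * (volume (G '' T) * volume S) := by
  have e : ∀ U : Set ℝ, MeasurableSet U →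
      ∫⁻ x in U, ENNReal.ofReal (deriv G x) = volume (G '' U) := fun U hU =>
    lintegral_deriv_eq_volume_image_of_monotoneOn hU
      (fun x _ => (hG x).hasDerivAt.hasDerivWithinAt) (hm.monotoneOn U)
  have hmeas : Measurable (fun x => ENNReal.ofReal (deriv G x)) :=
    (measurable_deriv G).ennreal_ofReal
  rw [← e S hS, ← e T hT]
  have h1 : ∀ y ∈ T, ∫⁻ x in S, ENNReal.ofReal (deriv G x)
      ≤ K * volume S * ENNReal.ofReal (deriv G y) := by
    intro y hy
    calc _ ≤ ∫⁻ x in S, K * ENNReal.ofReal (deriv G y) :=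
          setLIntegral_mono' hS (fun x hx => hK x hx y hy)
      _ = _ := by rw [setLIntegral_const]; ring
  calc _ = ∫⁻ y in T, (∫⁻ x in S, ENNReal.ofReal (deriv G x)) := by rw [setLIntegral_const]
    _ ≤ ∫⁻ y in T, K * volume S * ENNReal.ofReal (deriv G y) := setLIntegral_mono' hT h1
    _ = _ := by rw [lintegral_const_mul _ hmeas]; ring

lemma density {X : Type*} [MeasurableSpace X] (ν lam : Measure X) [IsFiniteMeasure ν]
    [IsFiniteMeasure lam] (c : NNReal) (hc : 1 ≤ c)
    (h1 : ∀ A, MeasurableSet A → ν A ≤ c * lam A)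
    (h2 : ∀ A, MeasurableSet A → lam A ≤ c * ν A) :
    ν ≪ lam ∧ ∀ᵐ x ∂lam, (c : ENNReal)⁻¹ ≤ ν.rnDeriv lam x ∧ ν.rnDeriv lam x ≤ c := by
  have hac : ν ≪ lam := Measure.AbsolutelyContinuous.mk fun s hs h => by
    have := h1 s hs; simpa [h] using this
  have hc0 : (c : ENNReal) ≠ 0 := by
    have : c ≠ 0 := (zero_lt_one.trans_le hc).ne'
    exact_mod_cast this
  refine ⟨hac, ?_⟩
  have a1 : (fun _ => (c : ENNReal)⁻¹) ≤ᵐ[lam] ν.rnDeriv lam := by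
    refine ae_le_of_forall_setLIntegral_le_of_sigmaFinite measurable_const fun s hs _ => ?_
    rw [Measure.setLIntegral_rnDeriv hac, setLIntegral_const]
    calc _ ≤ (c : ENNReal)⁻¹ * (c * ν s) := by gcongr; exact h2 s hs
      _ = _ := by rw [← mul_assoc, ENNReal.inv_mul_cancel hc0 (by simp), one_mul]
  have a2 : ν.rnDeriv lam ≤ᵐ[lam] (fun _ => (c : ENNReal)) := by
    refine ae_le_of_forall_setLIntegral_le_of_sigmaFinite (Measure.measurable_rnDeriv _ _) fun s hs _ => ?_
    rw [Measure.setLIntegral_rnDeriv hac, setLIntegral_const]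
    exact h1 s hs
  filter_upwards [a1, a2] with x h h' using ⟨h, h'⟩

lemma core (G : ℝ → ℝ) (g : AddCircle (1 : ℝ) → AddCircle (1 : ℝ)) (D : ℕ)
    (hlift : ∀ x : ℝ, g (x : AddCircle (1 : ℝ)) = (G x : AddCircle (1 : ℝ)))
    (hg : Measurable g)
    (hG : Differentiable ℝ G) (hdeg : ∀ x, G (x + 1) = G x + D)
    (b : ℝ) (hb : 0 < b) (hexp : ∀ x, b ≤ deriv G x) (K : ENNReal)
    (hK : ∀ x y, |G x - G y| ≤ 1 →
      ENNReal.ofReal (deriv G x) ≤ K * ENNReal.ofReal (deriv G y))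
    (A : Set (AddCircle (1 : ℝ))) (hA : MeasurableSet A) :
    Measure.map g volume A ≤ K * volume A ∧ volume A ≤ K * Measure.map g volume A := by
  have hmono : StrictMono G := strictMono_of_deriv_pos (fun x => hb.trans_le (hexp x))
  have hsurj : Function.Surjective G := by
    intro t
    apply mem_range_of_exists_le_of_exists_ge hG.continuous
    · refine ⟨-(|t - G 0| / b), ?_⟩
      have h0 : 0 ≤ |t - G 0| / b := by positivity
      have := mul_sub_le_image_sub_of_le_deriv hG hexp (neg_nonpos.2 h0)
      rw [sub_neg_eq_add, zero_add, mul_div_cancel₀ _ hb.ne'] at this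
      linarith [neg_abs_le (t - G 0)]
    · refine ⟨(|t - G 0| / b), ?_⟩
      have h0 : 0 ≤ |t - G 0| / b := by positivity
      have := mul_sub_le_image_sub_of_le_deriv hG hexp h0
      rw [sub_zero, mul_div_cancel₀ _ hb.ne'] at this
      linarith [le_abs_self (t - G 0)]
  choose h hh using fun k : ℕ => hsurj (k : ℝ)
  have hhm : Monotone h := by
    intro i j hij
    rw [← hmono.le_iff_le, hh, hh]
    exact_mod_cast hij
  have hD : h D = h 0 + 1 := by
    apply hmono.injective
    rw [hh, hdeg, hh]; simp
  let A' : Set ℝ := QuotientAddGroup.mk ⁻¹' A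
  have hq : Measurable (QuotientAddGroup.mk : ℝ → AddCircle (1:ℝ)) :=
    (AddCircle.continuous_mk' (1:ℝ)).measurable
  have hA' : MeasurableSet A' := hq hA
  have volA : ∀ t : ℝ, volume A = volume (A' ∩ Set.Ioc t (t + 1)) := by
    intro t
    rw [← (AddCircle.measurePreserving_mk 1 t).measure_preimage hA.nullMeasurableSet,
      Measure.restrict_apply hA']
  let B : Set ℝ := G ⁻¹' A'
  have hB : MeasurableSet B := hG.continuous.measurable hA'
  have hpre : QuotientAddGroup.mk ⁻¹' (g ⁻¹' A) = B := by
    ext x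
    simp only [B, A', Set.mem_preimage]
    rw [← hlift x]
  have volB : Measure.map g volume A = volume (B ∩ Set.Ioc (h 0) (h D)) := by
    rw [Measure.map_apply hg hA,
      ← (AddCircle.measurePreserving_mk 1 (h 0)).measure_preimage (hg hA).nullMeasurableSet,
      hpre, Measure.restrict_apply hB, hD]
  let J : ℕ → Set ℝ := fun k => Set.Ioc (h k) (h (k+1))
  have hJ : ∀ k, MeasurableSet (J k) := fun k => measurableSet_Ioc
  have hsum : ∀ S : Set ℝ, MeasurableSet S →
      volume (S ∩ Set.Ioc (h 0) (h D)) = ∑ k ∈ Finset.range D, volume (S ∩ J k) := by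
    intro S hS
    rw [← measure_biUnion_finset]
    · congr 1
      rw [← hhm.biUnion_Ico_Ioc_map_succ 0 D, Set.inter_iUnion₂]
      simp [J]
    · intro i _ j _ hij
      exact (hhm.pairwise_disjoint_on_Ioc_succ hij).mono Set.inter_subset_right
        Set.inter_subset_right
    · exact fun k _ => hS.inter (hJ k)
  have hGJ : ∀ k, G '' (J k) = Set.Ioc (k : ℝ) (k + 1) := by
    intro k
    ext y
    constructor
    · rintro ⟨x, hx, rfl⟩
      have h1 := hmono hx.1
      have h2 := hmono.monotone hx.2
      rw [hh] at h1 h2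
      exact ⟨h1, by exact_mod_cast h2⟩
    · rintro ⟨h1, h2⟩
      obtain ⟨x, rfl⟩ := hsurj y
      refine ⟨x, ⟨?_, ?_⟩, rfl⟩
      · rw [← hmono.lt_iff_lt, hh]; exact h1
      · rw [← hmono.le_iff_le, hh]; exact_mod_cast h2
  have hGB : ∀ k, G '' (B ∩ J k) = A' ∩ Set.Ioc (k : ℝ) (k + 1) := by
    intro k
    rw [← hGJ, Set.inter_comm, Set.image_inter_preimage, Set.inter_comm]
  have hKJ : ∀ k, ∀ x ∈ J k, ∀ y ∈ J k,
      ENNReal.ofReal (deriv G x) ≤ K * ENNReal.ofReal (deriv G y) := by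
    intro k x hx y hy
    apply hK
    have h1 : G x ∈ G '' J k := ⟨x, hx, rfl⟩
    have h2 : G y ∈ G '' J k := ⟨y, hy, rfl⟩
    rw [hGJ] at h1 h2
    rw [abs_le]
    constructor <;> linarith [h1.1, h1.2, h2.1, h2.2]
  have p1 : ∀ k, volume A * volume (J k) ≤ K * volume (B ∩ J k) := by
    intro k
    have := vol_pair G hG hmono.monotone K (B ∩ J k) (J k) (hB.inter (hJ k)) (hJ k)
      (fun x hx y hy => hKJ k x hx.2 y hy)
    rw [hGB, ← volA, hGJ] at this
    simpa using this
  have p2 : ∀ k, volume (B ∩ J k) ≤ K * (volume A * volume (J k)) := by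
    intro k
    have := vol_pair G hG hmono.monotone K (J k) (B ∩ J k) (hJ k) (hB.inter (hJ k))
      (fun x hx y hy => hKJ k x hx y hy.2)
    rw [hGB, ← volA, hGJ] at this
    simpa using this
  have tot : ∑ k ∈ Finset.range D, volume (J k) = 1 := by
    have := hsum Set.univ MeasurableSet.univ
    simp only [Set.univ_inter] at this
    rw [← this, hD]; simp
  have tot' : volume A = ∑ k ∈ Finset.range D, volume A * volume (J k) := by
    rw [← Finset.mul_sum, tot, mul_one]
  rw [volB, hsum B hB]
  constructor
  · calc _ ≤ ∑ k ∈ Finset.range D, K * (volume A * volume (J k)) :=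
        Finset.sum_le_sum fun k _ => p2 k
      _ = _ := by rw [← Finset.mul_sum, ← tot']
  · calc _ = ∑ k ∈ Finset.range D, volume A * volume (J k) := tot'
      _ ≤ ∑ k ∈ Finset.range D, K * volume (B ∩ J k) := Finset.sum_le_sum fun k _ => p1 k
      _ = _ := by rw [← Finset.mul_sum]

/-- For a `C²` expanding circle map `f` of degree `d ≥ 2`, there is a constant `c ≥ 1`
such that for every `n ≥ 1` the push-forward `fⁿ_*λ` of the Haar (Lebesgue) measure `λ`
is absolutely continuous with respect to `λ`, with Radon–Nikodym derivative
`ρₙ = d(fⁿ_*λ)/dλ` satisfying `c⁻¹ ≤ ρₙ ≤ c` λ-almost everywhere. -/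
theorem stmt7 (d : ℕ) (hd : 2 ≤ d)
    (f : AddCircle (1 : ℝ) → AddCircle (1 : ℝ)) (F : ℝ → ℝ)
    (hlift : ∀ x : ℝ, f (x : AddCircle (1 : ℝ)) = (F x : AddCircle (1 : ℝ)))
    (hsmooth : ContDiff ℝ 2 F)
    (hdeg : ∀ x : ℝ, F (x + 1) = F x + d)
    (hexp : ∃ C > (0 : ℝ), ∃ μ > (1 : ℝ), ∀ x : ℝ, ∀ n : ℕ,
      C * μ ^ n ≤ deriv (F^[n]) x) :
    ∃ c : NNReal, 1 ≤ c ∧ ∀ n : ℕ, 1 ≤ n →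
      (Measure.map (f^[n]) volume ≪ (volume : Measure (AddCircle (1 : ℝ)))) ∧
      ∀ᵐ x ∂(volume : Measure (AddCircle (1 : ℝ))),
        (c : ENNReal)⁻¹ ≤ (Measure.map (f^[n]) volume).rnDeriv volume x ∧
          (Measure.map (f^[n]) volume).rnDeriv volume x ≤ (c : ENNReal) := by
  obtain ⟨C, hC, μ, hμ, hexp⟩ := hexp
  obtain ⟨M, hM, hdist⟩ := distortion F d hsmooth hdeg C hC μ hμ hexp
  have hFd : Differentiable ℝ F := hsmooth.differentiable (by norm_num)
  have hf : Continuous f := by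
    have hq : Topology.IsQuotientMap (QuotientAddGroup.mk : ℝ → AddCircle (1 : ℝ)) :=
      QuotientAddGroup.isQuotientMap_mk _
    rw [hq.continuous_iff]
    have : f ∘ (QuotientAddGroup.mk : ℝ → AddCircle (1 : ℝ)) =
        (QuotientAddGroup.mk : ℝ → AddCircle (1 : ℝ)) ∘ F := funext hlift
    rw [this]
    exact (AddCircle.continuous_mk' (1:ℝ)).comp hFd.continuous
  have hμ0 : 0 < μ := by linarith
  have hpos : ∀ n x, 0 < deriv (F^[n]) x := fun n x =>
    lt_of_lt_of_le (by positivity) (hexp x n)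
  refine ⟨(Real.exp M).toNNReal, Real.one_le_toNNReal.2 (Real.one_le_exp hM), ?_⟩
  intro n hn1
  clear hn1
  have hfn : Measurable (f^[n]) := (hf.iterate n).measurable
  have hliftn : ∀ x : ℝ, f^[n] (x : AddCircle (1 : ℝ)) = (F^[n] x : AddCircle (1 : ℝ)) := by
    induction n with
    | zero => intro x; rfl
    | succ n ih =>
      intro x
      rw [Function.iterate_succ_apply, Function.iterate_succ_apply, hlift]
      exact ih (hf.iterate n).measurable (F x)
  have hnat : ∀ (k : ℕ) x, F (x + k) = F x + (d * k : ℕ) := by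
    intro k
    induction k with
    | zero => intro x; simp
    | succ k ih =>
      intro x
      have := ih x
      push_cast at this ⊢
      rw [← add_assoc, hdeg, this]; ring
  have hdegn : ∀ x, F^[n] (x + 1) = F^[n] x + (d ^ n : ℕ) := by
    clear hfn hliftn
    induction n with
    | zero => intro x; simp
    | succ n ih =>
      intro x
      rw [Function.iterate_succ_apply', Function.iterate_succ_apply', ih, hnat, pow_succ']
  have hc : ∀ A, MeasurableSet A → _ := fun A hA =>
    core (F^[n]) (f^[n]) (d ^ n) hliftn hfn (hFd.iterate n) hdegn (C * μ ^ n) (by positivity)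
      (fun x => hexp x n) (ENNReal.ofReal (Real.exp M)) (by
        intro x y hxy
        rw [← ENNReal.ofReal_mul (Real.exp_pos M).le]
        apply ENNReal.ofReal_le_ofReal
        have h1 := (hdist n x y).trans (mul_le_of_le_one_right hM hxy)
        have h2 : Real.log (deriv (F^[n]) x) ≤ M + Real.log (deriv (F^[n]) y) := by
          linarith [le_abs_self (Real.log (deriv (F^[n]) x) - Real.log (deriv (F^[n]) y))]
        rw [← Real.exp_log (hpos n x), ← Real.exp_log (hpos n y), ← Real.exp_add]
        exact Real.exp_le_exp.2 h2) A hA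
  have : IsFiniteMeasure (Measure.map (f^[n]) (volume : Measure (AddCircle (1 : ℝ)))) :=
    inferInstance
  exact density _ _ _ (Real.one_le_toNNReal.2 (Real.one_le_exp hM))
    (fun A hA => (hc A hA).1) (fun A hA => (hc A hA).2)
end

section
/- Let f : S¹ → S¹ be a C² expanding circle map of degree d ≥ 2. Then f admits an f-invariant Borel probability measure ν absolutely continuous with respect to λ whose density dν/dλ has a representative ρ : S¹ → ℝ that is Lipschitz continuous and satisfies c⁻¹ ≤ ρ(x) ≤ c for all x ∈ S¹, for some constant c ≥ 1. -/
open MeasureTheory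

section Aux
open Filter Topology

lemma inv_branch (d : ℕ) (F : ℝ → ℝ)
    (hsmooth : ContDiff ℝ 2 F)
    (hdeg : ∀ x : ℝ, F (x + 1) = F x + d)
    (hexp : ∃ C > (0 : ℝ), ∃ μ > (1 : ℝ), ∀ x : ℝ, ∀ n : ℕ,
      C * μ ^ n ≤ deriv (F^[n]) x) :
    ∃ G w : ℝ → ℝ, ∃ K : ℝ, 0 ≤ K ∧ (∀ y, F (G y) = y) ∧ (∀ x, G (F x) = x) ∧
      StrictMono G ∧ 
      (∀ y, HasDerivAt G (w y) y) ∧ (∀ y, 0 < w y) ∧ Continuous w ∧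
      (∀ n : ℕ, ∀ y y', ∏ j ∈ Finset.range n, w (G^[j] y) ≤
        Real.exp (K * |y - y'|) * ∏ j ∈ Finset.range n, w (G^[j] y')) := by
  obtain ⟨C, hC, μ, hμ, hexp⟩ := hexp
  have hdF : Differentiable ℝ F := hsmooth.differentiable (by norm_num)
  have hc : 0 < C * μ := by positivity
  have hF' : ∀ x, C * μ ≤ deriv F x := fun x => by simpa using hexp x 1
  have hpos : ∀ x, 0 < deriv F x := fun x => hc.trans_le (hF' x)
  have hmono : StrictMono F := strictMono_of_deriv_pos hpos
  have hgrow : ∀ x y, x ≤ y → C * μ * (y - x) ≤ F y - F x := fun x y h =>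
    mul_sub_le_image_sub_of_le_deriv hdF hF' h
  have hsurj : Function.Surjective F := by
    apply hdF.continuous.surjective
    · refine tendsto_atTop_mono' _ (f₁ := fun x => C * μ * x + F 0) ?_ ?_
      · filter_upwards [eventually_ge_atTop 0] with x hx
        have := hgrow 0 x hx
        linarith
      · exact tendsto_atTop_add_const_right _ _ (tendsto_id.const_mul_atTop hc)
    · refine tendsto_atBot_mono' _ (f₁ := fun x => C * μ * x + F 0) ?_ ?_
      · filter_upwards [eventually_le_atBot 0] with x hx
        have := hgrow x 0 hx
        linarith
      · exact tendsto_atBot_add_const_right _ _ (tendsto_id.const_mul_atBot hc)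
  let e := hmono.orderIsoOfSurjective F hsurj
  have he : ∀ x, e x = F x := fun x => rfl
  let G : ℝ → ℝ := e.symm
  have hFG : ∀ y, F (G y) = y := fun y => e.apply_symm_apply y
  have hGF : ∀ x, G (F x) = x := fun x => e.symm_apply_apply x
  have hGc : Continuous G := e.symm.continuous
  let w : ℝ → ℝ := fun y => (deriv F (G y))⁻¹
  have hGd : ∀ y, HasDerivAt G (w y) y := fun y =>
    HasDerivAt.of_local_left_inverse hGc.continuousAt (hdF (G y)).hasDerivAt (hpos _).ne'
      (Eventually.of_forall hFG)
  have hF1 : ContDiff ℝ 1 (deriv F) := hsmooth.deriv' 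
  have hw : ∀ y, 0 < w y := fun y => inv_pos.2 (hpos _)
  have hwc : Continuous w := (hF1.continuous.comp hGc).inv₀ fun y => (hpos _).ne'
  have hF'per : ∀ x, deriv F (x + 1) = deriv F x := by
    intro x
    have : (fun x => F (x + 1)) = fun x => F x + d := funext hdeg
    have h2 := congrArg (fun g => deriv g x) this
    simpa [deriv_comp_add_const] using h2
  have hF''per : Function.Periodic (deriv (deriv F)) 1 := by
    intro x
    have : (fun x => deriv F (x + 1)) = fun x => deriv F x := funext hF'per
    have h2 := congrArg (fun g => deriv g x) this
    simpa [deriv_comp_add_const] using h2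
  have hF''c : Continuous (deriv (deriv F)) := hF1.continuous_deriv (by norm_num)
  obtain ⟨B, hB⟩ : ∃ B, ∀ x, ‖deriv (deriv F) x‖ ≤ B := by
    obtain ⟨B, hB⟩ := (hF''per.isBounded_of_continuous one_ne_zero hF''c).exists_norm_le
    exact ⟨B, fun x => hB _ ⟨x, rfl⟩⟩
  have hB0 : 0 ≤ B := (norm_nonneg _).trans (hB 0)
  have hlip : ∀ x y, |deriv F y - deriv F x| ≤ B * |y - x| := fun x y =>
    Convex.norm_image_sub_le_of_norm_deriv_le (s := Set.univ)
      (fun z _ => hF1.differentiable (by norm_num) z) (fun z _ => hB z) convex_univ trivial trivial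
  have hGn : ∀ n y, HasDerivAt (G^[n]) (∏ j ∈ Finset.range n, w (G^[j] y)) y := by
    intro n
    induction n with
    | zero => intro y; simpa using hasDerivAt_id y
    | succ n ih =>
      intro y
      rw [Function.iterate_succ', Finset.prod_range_succ, mul_comm]
      exact (hGd _).comp y (ih y)
  have hFn : ∀ n, Differentiable ℝ (F^[n]) := fun n => hdF.iterate n
  have hinv : ∀ n, Function.LeftInverse (F^[n]) (G^[n]) := fun n =>
    Function.LeftInverse.iterate hFG n
  have hcontr : ∀ n y, |∏ j ∈ Finset.range n, w (G^[j] y)| ≤ C⁻¹ * (μ⁻¹) ^ n := by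
    intro n y
    have h1 : HasDerivAt (F^[n] ∘ G^[n]) _ y := (hFn n (G^[n] y)).hasDerivAt.comp y (hGn n y)
    rw [(hinv n).comp_eq_id] at h1
    have h2 := h1.unique (hasDerivAt_id y)
    have h3 := hexp (G^[n] y) n
    have h4 : 0 < ∏ j ∈ Finset.range n, w (G^[j] y) := Finset.prod_pos fun j _ => hw _
    rw [abs_of_pos h4, inv_pow, ← mul_inv, ← one_div, le_div_iff₀ (by positivity)]
    calc _ ≤ _ := mul_le_mul_of_nonneg_left h3 h4.le
      _ = 1 := by rw [mul_comm]; exact h2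
  have hGnlip : ∀ n y y', |G^[n] y - G^[n] y'| ≤ C⁻¹ * (μ⁻¹) ^ n * |y - y'| := fun n y y' =>
    Convex.norm_image_sub_le_of_norm_hasDerivWithin_le (s := Set.univ)
      (fun z _ => (hGn n z).hasDerivWithinAt) (fun z _ => hcontr n z) convex_univ trivial trivial
  have hwlip : ∀ y y', w y ≤ Real.exp (B / (C * μ) * |G y - G y'|) * w y' := by
    intro y y'
    have h1 : deriv F (G y') ≤ Real.exp (B / (C * μ) * |G y - G y'|) * deriv F (G y) := by
      have h2 := (abs_le.1 (hlip (G y) (G y'))).2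
      rw [abs_sub_comm] at h2
      have h3 := Real.add_one_le_exp (B / (C * μ) * |G y - G y'|)
      have h4 : B * |G y - G y'| ≤ B / (C * μ) * |G y - G y'| * deriv F (G y) := by
        calc B * |G y - G y'| = B / (C * μ) * |G y - G y'| * (C * μ) := by field_simp
          _ ≤ _ := mul_le_mul_of_nonneg_left (hF' _) (by positivity)
      have h5 := mul_le_mul_of_nonneg_right h3 (hpos (G y)).le
      linarith
    show (deriv F (G y))⁻¹ ≤ _ * (deriv F (G y'))⁻¹
    rw [← div_eq_mul_inv, le_div_iff₀ (hpos _), inv_mul_le_iff₀ (hpos _), mul_comm]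
    exact h1
  have hr0 : 0 ≤ μ⁻¹ := by positivity
  have hr1 : μ⁻¹ < 1 := inv_lt_one_of_one_lt₀ hμ
  have hK : 0 ≤ B / (C * μ) * C⁻¹ := by positivity
  refine ⟨G, w, B / (C * μ) * C⁻¹ * (1 - μ⁻¹)⁻¹, mul_nonneg hK (inv_nonneg.2 (by linarith)),
    hFG, hGF, e.symm.strictMono, hGd, hw, hwc, ?_⟩
  intro n y y'
  have key : ∏ j ∈ Finset.range n, w (G^[j] y) ≤
      Real.exp (B / (C * μ) * C⁻¹ * (∑ j ∈ Finset.range n, (μ⁻¹) ^ j) * |y - y'|) *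
        ∏ j ∈ Finset.range n, w (G^[j] y') := by
    induction n with
    | zero => simp
    | succ n ih =>
      rw [Finset.prod_range_succ, Finset.prod_range_succ, Finset.sum_range_succ, mul_add, add_mul,
        Real.exp_add]
      have h1 : w (G^[n] y) ≤ Real.exp (B / (C * μ) * C⁻¹ * (μ⁻¹) ^ n * |y - y'|) * w (G^[n] y') := by
        refine (hwlip _ _).trans (mul_le_mul_of_nonneg_right (Real.exp_le_exp.2 ?_) (hw _).le)
        rw [← Function.iterate_succ_apply' G, ← Function.iterate_succ_apply' G]
        have h2 := hGnlip (n+1) y y'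
        have h3 : C⁻¹ * (μ⁻¹) ^ (n+1) * |y - y'| ≤ C⁻¹ * (μ⁻¹) ^ n * |y - y'| := by
          have : (μ⁻¹) ^ (n+1) ≤ (μ⁻¹) ^ n := pow_le_pow_of_le_one hr0 hr1.le (Nat.le_succ n)
          gcongr
        calc _ ≤ B / (C * μ) * (C⁻¹ * (μ⁻¹) ^ n * |y - y'|) :=
              mul_le_mul_of_nonneg_left (h2.trans h3) (by positivity)
          _ = _ := by ring
      calc _ ≤ _ := mul_le_mul ih h1 (hw _).le
            (mul_nonneg (Real.exp_pos _).le (Finset.prod_nonneg fun j _ => (hw _).le))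
        _ = _ := by ring
  refine key.trans (mul_le_mul_of_nonneg_right (Real.exp_le_exp.2 ?_)
    (Finset.prod_nonneg fun j _ => (hw _).le))
  have hs : ∑ j ∈ Finset.range n, (μ⁻¹) ^ j ≤ (1 - μ⁻¹)⁻¹ := by
    rw [← tsum_geometric_of_lt_one hr0 hr1]
    exact (summable_geometric_of_lt_one hr0 hr1).sum_le_tsum _ (fun i _ => by positivity)
  gcongr


lemma sum_range_mul_aux (a : ℕ → ℝ) (d m : ℕ) :
    ∑ i ∈ Finset.range (d * m), a i =
      ∑ k ∈ Finset.range d, ∑ j ∈ Finset.range m, a (k + d * j) := by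
  rw [Finset.sum_comm]
  induction m with
  | zero => simp
  | succ m ih =>
    rw [Nat.mul_succ, Finset.sum_range_add, Finset.sum_range_succ, ih]
    simp only [add_comm]

lemma exists_density (d : ℕ) (G w : ℝ → ℝ) (K : ℝ) (hK : 0 ≤ K)
    (hGm : ∀ y (m : ℕ), G (y + d * m) = G y + m)
    (hGd : ∀ y, HasDerivAt G (w y) y) (hw : ∀ y, 0 < w y)
    (hdist : ∀ n : ℕ, ∀ y y', ∏ j ∈ Finset.range n, w (G^[j] y) ≤
        Real.exp (K * |y - y'|) * ∏ j ∈ Finset.range n, w (G^[j] y')) :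
    ∃ ρ : ℝ → ℝ, (∀ x, ρ (x + 1) = ρ x) ∧
      (∀ x, Real.exp (-K) ≤ ρ x ∧ ρ x ≤ Real.exp K) ∧
      (∀ x y, ρ x ≤ Real.exp (K * |x - y|) * ρ y) ∧
      (∀ y, ∑ k ∈ Finset.range d, w (y + k) * ρ (G (y + k)) = ρ y) := by
  have hGn : ∀ n y, HasDerivAt (G^[n]) (∏ j ∈ Finset.range n, w (G^[j] y)) y := by
    intro n
    induction n with
    | zero => intro y; simpa using hasDerivAt_id y
    | succ n ih =>
      intro y
      rw [Function.iterate_succ', Finset.prod_range_succ, mul_comm]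
      exact (hGd _).comp y (ih y)
  have hGnm : ∀ n y (m : ℕ), G^[n] (y + d ^ n * m) = G^[n] y + m := by
    intro n
    induction n with
    | zero => intro y m; simp
    | succ n ih =>
      intro y m
      have := hGm y (d ^ n * m)
      push_cast at this
      rw [Function.iterate_succ_apply, Function.iterate_succ_apply, pow_succ', mul_assoc, this, ih]
  have hwper : ∀ y (m : ℕ), w (y + d * m) = w y := by
    intro y m
    have h1 : HasDerivAt (fun y => G (y + d * m)) (w (y + d * m)) y :=
      (hGd (y + d * m)).comp_add_const y _
    have h2 : HasDerivAt (fun y => G y + m) (w y) y := (hGd y).add_const _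
    rw [← funext fun y => hGm y m] at h2
    exact h1.unique h2
  let W : ℕ → ℝ → ℝ := fun n y => ∏ j ∈ Finset.range n, w (G^[j] y)
  let r : ℕ → ℝ → ℝ := fun n y => ∑ k ∈ Finset.range (d ^ n), W n (y + k)
  have hWpos : ∀ n y, 0 < W n y := fun n y => Finset.prod_pos fun j _ => hw _
  have hWper : ∀ n y, W n (y + d ^ n) = W n y := by
    intro n y
    have h1 : HasDerivAt (fun y => G^[n] (y + d ^ n)) (W n (y + d ^ n)) y :=
      (hGn n (y + d ^ n)).comp_add_const y _
    have h2 : HasDerivAt (fun y => G^[n] y + 1) (W n y) y := (hGn n y).add_const _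
    have h3 : (fun y => G^[n] (y + d ^ n)) = fun y => G^[n] y + 1 := by
      funext y; simpa using hGnm n y 1
    rw [← h3] at h2
    exact h1.unique h2
  have hrper : ∀ n y, r n (y + 1) = r n y := by
    intro n y
    have h1 := Finset.sum_range_succ (fun k : ℕ => W n (y + k)) (d ^ n)
    have h2 := Finset.sum_range_succ' (fun k : ℕ => W n (y + k)) (d ^ n)
    have h3 : r n (y + 1) = ∑ k ∈ Finset.range (d ^ n), W n (y + ((k + 1 : ℕ) : ℝ)) := by
      refine Finset.sum_congr rfl fun k _ => ?_
      congr 1; push_cast; ring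
    have h4 := hWper n y
    push_cast at h1 h2 h3
    simp only [r] at h3 ⊢
    simp only [add_zero] at h2
    linarith
  have hrrec : ∀ n y, ∑ k ∈ Finset.range d, w (y + k) * r n (G (y + k)) = r (n + 1) y := by
    intro n y
    simp only [r]
    rw [pow_succ', sum_range_mul_aux]
    refine Finset.sum_congr rfl fun k _ => ?_
    rw [Finset.mul_sum]
    refine Finset.sum_congr rfl fun j _ => ?_
    have e : y + ((k + d * j : ℕ) : ℝ) = y + k + d * j := by push_cast; ring
    rw [e]
    simp only [W]
    rw [Finset.prod_range_succ', mul_comm]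
    simp only [Function.iterate_succ_apply, Function.iterate_zero, id, hwper, hGm]
  have hrdist : ∀ n y y', r n y ≤ Real.exp (K * |y - y'|) * r n y' := by
    intro n y y'
    simp only [r]
    rw [Finset.mul_sum]
    refine Finset.sum_le_sum fun k _ => ?_
    have := hdist n (y + k) (y' + k)
    rwa [add_sub_add_right_eq_sub] at this
  have hone : ∀ n, ∃ c ∈ Set.Ioo (0:ℝ) 1, r n c = 1 := by
    intro n
    have hH : ∀ y, HasDerivAt (fun y => ∑ k ∈ Finset.range (d ^ n), G^[n] (y + k)) (r n y) y := by
      intro y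
      exact HasDerivAt.fun_sum fun k _ => (hGn n (y + k)).comp_add_const y _
    obtain ⟨c, hc, h⟩ := exists_hasDerivAt_eq_slope _ (r n) zero_lt_one
      (fun y _ => (hH y).continuousAt.continuousWithinAt) (fun y _ => hH y)
    refine ⟨c, hc, ?_⟩
    rw [h, ← Finset.sum_sub_distrib]
    have h1 := Finset.sum_range_sub (fun k : ℕ => G^[n] k) (d ^ n)
    have h2 := hGnm n 0 1
    simp only [Nat.cast_add, Nat.cast_one, Nat.cast_pow, Nat.cast_zero, mul_one, zero_add] at h1 h2
    simp only [zero_add, sub_zero, div_one]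
    rw [h2] at h1
    simp only [add_comm (1:ℝ)]
    linarith
  have hrb : ∀ n x, Real.exp (-K) ≤ r n x ∧ r n x ≤ Real.exp K := by
    intro n x
    have hp : Function.Periodic (r n) 1 := hrper n
    obtain ⟨y, hy, hxy⟩ := hp.exists_mem_Ico₀ zero_lt_one x
    rw [hxy]
    obtain ⟨c, hc, hrc⟩ := hone n
    have hd1 : |y - c| ≤ 1 := abs_le.2 ⟨by linarith [hy.1, hc.2], by linarith [hy.2, hc.1]⟩
    have h1 := hrdist n y c
    have h2 := hrdist n c y
    rw [abs_sub_comm] at h2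
    rw [hrc] at h1 h2
    have he : Real.exp (K * |y - c|) ≤ Real.exp K :=
      Real.exp_le_exp.2 (by nlinarith)
    have hy0 : 0 ≤ r n y := Finset.sum_nonneg fun k _ => (hWpos _ _).le
    constructor
    · rw [Real.exp_neg, inv_le_iff_one_le_mul₀ (Real.exp_pos _), mul_comm]
      exact h2.trans (mul_le_mul_of_nonneg_right he hy0)
    · linarith
  let A : ℕ → ℝ → ℝ := fun N x => (∑ n ∈ Finset.range (N + 1), r n x) / ((N : ℝ) + 1)
  have hN : ∀ N : ℕ, (0:ℝ) < (N:ℝ) + 1 := fun N => by positivity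
  have hAb : ∀ x N, A N x ∈ Set.Icc (Real.exp (-K)) (Real.exp K) := by
    intro x N
    constructor
    · rw [le_div_iff₀ (hN N)]
      have := Finset.card_nsmul_le_sum (Finset.range (N+1)) (fun n => r n x) _
        (fun n _ => (hrb n x).1)
      simp only [Finset.card_range, nsmul_eq_mul] at this
      push_cast at this
      linarith
    · rw [div_le_iff₀ (hN N)]
      have := Finset.sum_le_card_nsmul (Finset.range (N+1)) (fun n => r n x) _
        (fun n _ => (hrb n x).2)
      simp only [Finset.card_range, nsmul_eq_mul] at this
      push_cast at this
      linarith
  have hlim : ∀ x, ∃ l ∈ Set.Icc (Real.exp (-K)) (Real.exp K),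
      Tendsto (fun N => A N x) (hyperfilter ℕ) (𝓝 l) := by
    intro x
    obtain ⟨l, hl, h⟩ := (isCompact_Icc (a := Real.exp (-K)) (b := Real.exp K)).ultrafilter_le_nhds
      ((hyperfilter ℕ).map fun N => A N x)
      (by
        rw [le_principal_iff]
        exact Filter.mem_map.2 (Filter.univ_mem' (hAb x)))
    exact ⟨l, hl, h⟩
  choose ρ hρb hρ using hlim
  refine ⟨ρ, ?_, hρb, ?_, ?_⟩
  · intro x
    refine tendsto_nhds_unique (hρ (x + 1)) ?_
    simpa only [A, hrper] using hρ x
  · intro x y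
    refine le_of_tendsto_of_tendsto' (hρ x) ((hρ y).const_mul _) fun N => ?_
    simp only [A]
    rw [← mul_div_assoc, Finset.mul_sum]
    exact div_le_div_of_nonneg_right (Finset.sum_le_sum fun n _ => hrdist n x y) (hN N).le
  · intro y
    have h1 : Tendsto (fun N => ∑ k ∈ Finset.range d, w (y + k) * A N (G (y + k)))
        (hyperfilter ℕ) (𝓝 (∑ k ∈ Finset.range d, w (y + k) * ρ (G (y + k)))) :=
      tendsto_finsetSum _ fun k _ => (hρ _).const_mul _
    have h2 : ∀ N, ∑ k ∈ Finset.range d, w (y + k) * A N (G (y + k)) =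
        A N y + (r (N + 1) y - r 0 y) / ((N : ℝ) + 1) := by
      intro N
      have : ∑ k ∈ Finset.range d, w (y + k) * A N (G (y + k)) =
          (∑ n ∈ Finset.range (N + 1), r (n + 1) y) / ((N : ℝ) + 1) := by
        simp only [A, ← hrrec]
        rw [Finset.sum_comm, Finset.sum_div]
        refine Finset.sum_congr rfl fun k _ => ?_
        rw [← mul_div_assoc, Finset.mul_sum]
      rw [this]
      simp only [A]
      rw [← add_div]
      congr 1
      have h3 := Finset.sum_range_sub (fun n => r n y) (N + 1)
      rw [Finset.sum_sub_distrib] at h3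
      linarith
    have h3 : Tendsto (fun N : ℕ => (r (N + 1) y - r 0 y) / ((N : ℝ) + 1)) atTop (𝓝 0) := by
      have h4 : Tendsto (fun N : ℕ => Real.exp K * (1 / ((N : ℝ) + 1))) atTop (𝓝 0) := by
        simpa using tendsto_one_div_add_atTop_nhds_zero_nat.const_mul (Real.exp K)
      refine squeeze_zero_norm (fun N => ?_) h4
      rw [norm_div, Real.norm_eq_abs, Real.norm_eq_abs, abs_of_pos (hN N), mul_one_div]
      refine div_le_div_of_nonneg_right (abs_le.2 ?_) (hN N).le
      have a1 := hrb (N+1) y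
      have a2 := hrb 0 y
      have a3 := Real.exp_pos (-K)
      constructor <;> linarith
    have h5 := (hρ y).add (h3.mono_left Nat.hyperfilter_le_atTop)
    simp only [h2, add_zero] at h1 h5
    exact tendsto_nhds_unique h1 h5


lemma lintegral_Ioc_nat (h : ℝ → ENNReal) (d : ℕ) :
    ∫⁻ y in Set.Ioc (0:ℝ) d, h y =
      ∑ k ∈ Finset.range d, ∫⁻ y in Set.Ioc (0:ℝ) 1, h (y + k) := by
  induction d with
  | zero => simp
  | succ m ih =>
    have hu : Set.Ioc (0:ℝ) ((m + 1 : ℕ) : ℝ) = Set.Ioc (0:ℝ) m ∪ Set.Ioc (m:ℝ) (m + 1) := by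
      push_cast
      rw [Set.Ioc_union_Ioc_eq_Ioc (by positivity) (by linarith)]
    rw [hu, lintegral_union measurableSet_Ioc (Set.Ioc_disjoint_Ioc_of_le le_rfl), ih,
      Finset.sum_range_succ]
    congr 1
    have := (measurePreserving_add_right volume (m:ℝ)).setLIntegral_comp_preimage_emb
      (measurableEmbedding_addRight (m:ℝ)) h (Set.Ioc (m:ℝ) (m + 1))
    rw [← this]
    congr 2
    ext x
    simp only [Set.mem_preimage, Set.mem_Ioc]
    constructor <;> rintro ⟨a, b⟩ <;> constructor <;> linarith

lemma invariance (d : ℕ) 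
    (f : AddCircle (1 : ℝ) → AddCircle (1 : ℝ)) (F : ℝ → ℝ)
    (hlift : ∀ x : ℝ, f (x : AddCircle (1 : ℝ)) = (F x : AddCircle (1 : ℝ)))
    (G w : ℝ → ℝ) (hFG : ∀ y, F (G y) = y) (hGF : ∀ x, G (F x) = x) (hGs : StrictMono G)
    (hGm : ∀ y (m : ℕ), G (y + d * m) = G y + m)
    (hGd : ∀ y, HasDerivAt G (w y) y) (hw : ∀ y, 0 < w y) (hwc : Continuous w)
    (ρ : ℝ → ℝ) (hρc : Continuous ρ) (hρ0 : ∀ x, 0 ≤ ρ x)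
    (hρ : ∀ y, ∑ k ∈ Finset.range d, w (y + k) * ρ (G (y + k)) = ρ y)
    (ρc : AddCircle (1 : ℝ) → ℝ) (hρρ : ∀ x : ℝ, ρc x = ρ x)
    (g : AddCircle (1:ℝ) → ENNReal) (hg : Measurable g) :
    ∫⁻ b, g (f b) * ENNReal.ofReal (ρc b) = ∫⁻ b, g b * ENNReal.ofReal (ρc b) := by
  have hGc : Continuous G := continuous_iff_continuousAt.2 fun y => (hGd y).continuousAt
  rw [← AddCircle.lintegral_preimage 1 (G 0), ← AddCircle.lintegral_preimage 1 0]
  have him : Set.Ioc (G 0) (G 0 + 1) = G '' Set.Ioc (0:ℝ) d := by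
    have h1 : G 0 + 1 = G d := by simpa using (hGm 0 1).symm
    rw [h1]
    ext x
    constructor
    · rintro ⟨a, b⟩
      rw [← hGF x] at a b
      exact ⟨F x, ⟨hGs.lt_iff_lt.1 a, hGs.le_iff_le.1 b⟩, hGF x⟩
    · rintro ⟨y, ⟨a, b⟩, rfl⟩
      exact ⟨hGs a, hGs.monotone b⟩
  rw [him, lintegral_image_eq_lintegral_abs_deriv_mul measurableSet_Ioc
    (fun y _ => (hGd y).hasDerivWithinAt) hGs.injective.injOn, lintegral_Ioc_nat,
    ← lintegral_finsetSum]
  · rw [zero_add]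
    refine lintegral_congr fun y => ?_
    rw [hρρ, ← hρ y, ENNReal.ofReal_sum_of_nonneg (fun k _ => mul_nonneg (hw _).le (hρ0 _)),
      Finset.mul_sum]
    refine Finset.sum_congr rfl fun k hkk => ?_
    clear hkk
    have hk : ((y + k : ℝ) : AddCircle (1:ℝ)) = (y : AddCircle (1:ℝ)) := by
      have := AddCircle.coe_add_period (1:ℝ) y
      induction k with
      | zero => simp
      | succ k ih =>
        push_cast
        rw [← add_assoc, AddCircle.coe_add_period, ih]
    rw [hlift, hFG, hρρ, hk, abs_of_pos (hw _), ENNReal.ofReal_mul (hw _).le]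
    ring
  · intro k _
    simp only [hlift, hFG, hρρ]
    have hm : Measurable fun y : ℝ => (y : AddCircle (1:ℝ)) := AddCircle.measurable_mk'
    have : Measurable fun y : ℝ => g ((y + k : ℝ) : AddCircle (1:ℝ)) :=
      hg.comp (hm.comp (measurable_id.add_const _))
    have h2 : Measurable fun y : ℝ => ENNReal.ofReal |w (y + k)| := by fun_prop
    have h3 : Measurable fun y : ℝ => ENNReal.ofReal (ρ (G (y + k))) := by fun_prop
    exact h2.mul (this.mul h3)

end Aux

/-- A `C²` expanding circle map of degree `d ≥ 2` admits an invariant Borel probability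
measure `ν` absolutely continuous with respect to the Haar (Lebesgue) measure `λ`, whose
density has a Lipschitz continuous representative `ρ` satisfying `c⁻¹ ≤ ρ ≤ c`
everywhere, for some constant `c ≥ 1`. -/
theorem stmt8 (d : ℕ) (hd : 2 ≤ d)
    (f : AddCircle (1 : ℝ) → AddCircle (1 : ℝ)) (F : ℝ → ℝ)
    (hlift : ∀ x : ℝ, f (x : AddCircle (1 : ℝ)) = (F x : AddCircle (1 : ℝ)))
    (hsmooth : ContDiff ℝ 2 F)
    (hdeg : ∀ x : ℝ, F (x + 1) = F x + d)
    (hexp : ∃ C > (0 : ℝ), ∃ μ > (1 : ℝ), ∀ x : ℝ, ∀ n : ℕ,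
      C * μ ^ n ≤ deriv (F^[n]) x) :
    ∃ ν : Measure (AddCircle (1 : ℝ)), IsProbabilityMeasure ν ∧
      (∀ A : Set (AddCircle (1 : ℝ)), MeasurableSet A → ν (f ⁻¹' A) = ν A) ∧
      ν ≪ volume ∧
      ∃ ρ : AddCircle (1 : ℝ) → ℝ,
        (∃ K : NNReal, LipschitzWith K ρ) ∧
        (∃ c : ℝ, 1 ≤ c ∧ ∀ x, c⁻¹ ≤ ρ x ∧ ρ x ≤ c) ∧
        ν = volume.withDensity fun x => ENNReal.ofReal (ρ x) := by
  obtain ⟨G, w, K, hK, hFG, hGF, hGs, hGd, hw, hwc, hdist⟩ := inv_branch d F hsmooth hdeg hexp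
  have hFm : ∀ x (m : ℕ), F (x + m) = F x + d * m := by
    intro x m
    induction m with
    | zero => simp
    | succ m ih => push_cast; rw [← add_assoc, hdeg, ih]; ring
  have hGm : ∀ y (m : ℕ), G (y + d * m) = G y + m := by
    intro y m
    have := hFm (G y) m
    rw [hFG] at this
    rw [← this, hGF]
  obtain ⟨ρ, hper, hb, hlog, hfix⟩ := exists_density d G w K hK hGm hGd hw hdist
  have hfc : Continuous f := by
    refine (QuotientAddGroup.isQuotientMap_mk _).continuous_iff.2 ?_
    have : f ∘ (fun x : ℝ => (x : AddCircle (1:ℝ))) = fun x : ℝ => (F x : AddCircle (1:ℝ)) :=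
      funext hlift
    exact this ▸ (AddCircle.continuous_mk' 1).comp hsmooth.continuous
  have hp : Function.Periodic ρ 1 := hper
  let σ : AddCircle (1:ℝ) → ℝ := hp.lift
  have hσ : ∀ x : ℝ, σ x = ρ x := fun x => hp.lift_coe x
  have hσb : ∀ a, Real.exp (-K) ≤ σ a ∧ σ a ≤ Real.exp K := by
    intro a
    induction a using QuotientAddGroup.induction_on with
    | H x => exact hb x
  -- Lipschitz
  have hlip1 : ∀ a b, σ a - σ b ≤ K * Real.exp K * Real.exp K * dist a b := by
    intro a b
    induction a using QuotientAddGroup.induction_on with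
    | H x =>
    induction b using QuotientAddGroup.induction_on with
    | H y =>
    have hz : σ (x : AddCircle (1:ℝ)) = ρ (x - round (x - y)) := by
      have := hp.sub_int_mul_eq (x := x) (round (x - y))
      rw [mul_one] at this
      rw [this]
      exact hσ x
    have hdz : dist (x : AddCircle (1:ℝ)) (y : AddCircle (1:ℝ)) = |x - round (x - y) - y| := by
      rw [dist_eq_norm, ← AddCircle.coe_sub, UnitAddCircle.norm_eq]
      congr 1; ring
    have ht : |x - round (x - y) - y| ≤ 1 := by
      have := abs_sub_round (x - y)
      have e : x - round (x - y) - y = x - y - round (x - y) := by ring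
      rw [e]; linarith
    change σ (x : AddCircle (1:ℝ)) - σ (y : AddCircle (1:ℝ)) ≤
      _ * dist (x : AddCircle (1:ℝ)) (y : AddCircle (1:ℝ))
    rw [hdz, hz, hσ y]
    have h1 := hlog (x - round (x - y)) y
    set t := |x - round (x - y) - y|
    have ht0 : 0 ≤ t := abs_nonneg _
    have h2 : Real.exp (K * t) - 1 ≤ K * t * Real.exp K := by
      have h3 := Real.add_one_le_exp (-(K * t))
      have h4 : Real.exp (K * t) * Real.exp (-(K * t)) = 1 := by rw [← Real.exp_add]; simp
      have h5 := mul_le_mul_of_nonneg_left h3 (Real.exp_pos (K * t)).le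
      have h6 : Real.exp (K * t) ≤ Real.exp K := Real.exp_le_exp.2 (by nlinarith)
      have h7 := mul_le_mul_of_nonneg_left h6 (mul_nonneg hK ht0)
      linarith
    have hy := hb y
    have hy0 : 0 ≤ ρ y := (Real.exp_pos _).le.trans hy.1
    calc _ ≤ (Real.exp (K * t) - 1) * ρ y := by linarith
      _ ≤ (K * t * Real.exp K) * ρ y := mul_le_mul_of_nonneg_right h2 hy0
      _ ≤ (K * t * Real.exp K) * Real.exp K := mul_le_mul_of_nonneg_left hy.2 (by positivity)
      _ = _ := by ring
  have hM : 0 ≤ K * Real.exp K * Real.exp K := by positivity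
  have hσlip : LipschitzWith ⟨_, hM⟩ σ := by
    refine LipschitzWith.of_dist_le_mul fun a b => ?_
    rw [Real.dist_eq]
    refine abs_le.2 ⟨?_, hlip1 a b⟩
    have := hlip1 b a
    rw [dist_comm] at this
    change -(K * Real.exp K * Real.exp K * dist a b) ≤ _
    linarith
  have hσc : Continuous σ := hσlip.continuous
  have hρc : Continuous ρ := by
    have : ρ = fun x : ℝ => σ x := funext fun x => (hσ x).symm
    rw [this]
    exact hσc.comp (AddCircle.continuous_mk' 1)
  have hint : Integrable σ volume := hσc.integrable_of_hasCompactSupport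
    (HasCompactSupport.of_compactSpace σ)
  have hvol : (volume : Measure (AddCircle (1:ℝ))).real Set.univ = 1 := by
    simp [Measure.real, AddCircle.measure_univ]
  let I := ∫ a, σ a
  have hI1 : Real.exp (-K) ≤ I := by
    have := integral_mono (integrable_const _) hint (fun a => (hσb a).1)
    simpa [hvol] using this
  have hI2 : I ≤ Real.exp K := by
    have := integral_mono hint (integrable_const _) (fun a => (hσb a).2)
    simpa [hvol] using this
  have hI : 0 < I := (Real.exp_pos _).trans_le hI1
  let τ : AddCircle (1:ℝ) → ℝ := fun a => I⁻¹ * σ a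
  have hσpos : ∀ a, 0 < σ a := fun a => (Real.exp_pos _).trans_le (hσb a).1
  have hτpos : ∀ a, 0 < τ a := fun a => mul_pos (inv_pos.2 hI) (hσpos a)
  have hτc : Continuous τ := continuous_const.mul hσc
  refine ⟨volume.withDensity fun x => ENNReal.ofReal (τ x), ⟨?_⟩, ?_,
    withDensity_absolutelyContinuous _ _, τ, ?_, ?_, rfl⟩
  · rw [withDensity_apply _ MeasurableSet.univ, Measure.restrict_univ,
      ← ofReal_integral_eq_lintegral_ofReal (hint.const_mul _)
        (Filter.Eventually.of_forall fun a => (hτpos a).le), integral_const_mul]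
    change ENNReal.ofReal (I⁻¹ * I) = 1
    rw [inv_mul_cancel₀ hI.ne', ENNReal.ofReal_one]
  · intro A hA
    rw [withDensity_apply _ hA, withDensity_apply _ (hfc.measurable hA)]
    have key := invariance d f F hlift G w hFG hGF hGs hGm hGd hw hwc (fun x => I⁻¹ * ρ x)
      (continuous_const.mul hρc)
      (fun x => mul_nonneg (inv_pos.2 hI).le ((Real.exp_pos _).le.trans (hb x).1))
      (fun y => by
        rw [← hfix y, Finset.mul_sum]
        exact Finset.sum_congr rfl fun k _ => by ring)
      τ (fun x => by simp only [τ, hσ]) (A.indicator 1) (measurable_one.indicator hA)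
    rw [← lintegral_indicator hA, ← lintegral_indicator (hfc.measurable hA)]
    refine Eq.trans (lintegral_congr fun b => ?_) (key.trans (lintegral_congr fun b => ?_))
    · by_cases h : f b ∈ A <;> simp [h]
    · by_cases h : b ∈ A <;> simp [h]
  · exact ⟨_, (lipschitzWith_smul I⁻¹).comp hσlip⟩
  · refine ⟨Real.exp K * Real.exp K, ?_, fun a => ⟨?_, ?_⟩⟩
    · rw [← Real.exp_add]; exact Real.one_le_exp (by linarith)
    · rw [mul_inv, ← Real.exp_neg]
      refine mul_le_mul ?_ (hσb a).1 (Real.exp_pos _).le (inv_pos.2 hI).le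
      rw [Real.exp_neg]
      exact inv_anti₀ hI hI2
    · refine mul_le_mul ?_ (hσb a).2 (hσpos a).le (Real.exp_pos _).le
      rw [Real.exp_neg] at hI1
      exact inv_le_of_inv_le₀ (Real.exp_pos _) hI1
end

section
/- Let (X, μ) be a probability space and let T : X → X be an invertible measure-preserving transformation (T is a bijection, both T and T⁻¹ are measurable, and T preserves μ). Then for every integrable function φ ∈ L¹(μ), for μ-almost every x ∈ X, both limits lim_{n→∞} (1/n) Σ_{i=0}^{n−1} φ(Tⁱ(x)) and lim_{n→∞} (1/n) Σ_{i=0}^{n−1} φ(T⁻ⁱ(x)) exist and are equal. -/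
open MeasureTheory Filter Topology

/-- running maximum of the Birkhoff sums -/
noncomputable def bmax {X : Type*} (T : X → X) (g : X → ℝ) : ℕ → X → ℝ
  | 0 => fun _ => 0
  | n + 1 => fun x => max 0 (g x + bmax T g n (T x))

lemma bmax_nonneg {X : Type*} (T : X → X) (g : X → ℝ) (n : ℕ) (x : X) : 0 ≤ bmax T g n x := by
  cases n with
  | zero => exact le_rfl
  | succ n => exact le_max_left _ _

lemma bmax_mono {X : Type*} (T : X → X) (g : X → ℝ) (n : ℕ) :
    ∀ x, bmax T g n x ≤ bmax T g (n+1) x := by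
  induction n with
  | zero => exact fun x => bmax_nonneg T g 1 x
  | succ n ih =>
    intro x
    have := ih (T x)
    change max 0 (g x + bmax T g n (T x)) ≤ max 0 (g x + bmax T g (n+1) (T x))
    gcongr

lemma sum_le_bmax {X : Type*} (T : X → X) (g : X → ℝ) (n : ℕ) :
    ∀ x, ∑ i ∈ Finset.range n, g (T^[i] x) ≤ bmax T g n x := by
  induction n with
  | zero => intro x; simp [bmax]
  | succ n ih =>
    intro x
    rw [Finset.sum_range_succ']
    have := ih (T x)
    simp only [Function.iterate_succ, Function.comp, Function.iterate_zero, id] at this ⊢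
    refine le_trans ?_ (le_max_right _ _)
    linarith

lemma bmax_meas {X : Type*} [MeasurableSpace X] {T : X → X} {g : X → ℝ} (hT : Measurable T)
    (hg : Measurable g) (n : ℕ) : Measurable (bmax T g n) := by
  induction n with
  | zero => exact measurable_const
  | succ n ih => exact measurable_const.max (hg.add (ih.comp hT))

lemma bmax_int {X : Type*} [MeasurableSpace X] {μ : Measure X} [IsProbabilityMeasure μ]
    {T : X → X} {g : X → ℝ} (hT : MeasurePreserving T μ μ)
    (hg : Integrable g μ) (n : ℕ) : Integrable (bmax T g n) μ := by
  induction n with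
  | zero => exact integrable_const _
  | succ n ih => exact (integrable_const (0:ℝ)).sup (hg.add (hT.integrable_comp_of_integrable ih))

lemma bmax_bdd {X : Type*} [MeasurableSpace X] {μ : Measure X} [IsProbabilityMeasure μ]
    {T : X → X} {g : X → ℝ} (hT : MeasurePreserving T μ μ) (hm : Measurable g)
    (hg : Integrable g μ) (ε : ℝ) (hε : 0 < ε)
    (h : ∀ A, MeasurableSet[MeasurableSpace.invariants T] A → ∫ x in A, g x ∂μ = - ε * μ.real A) :
    ∀ᵐ x ∂μ, BddAbove (Set.range fun n => bmax T g n x) := by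
  set B : Set X := {x | BddAbove (Set.range fun n => bmax T g n x)} with hB
  have hBm : MeasurableSet B := measurableSet_bddAbove_range (fun n => bmax_meas hT.measurable hm n)
  have hBT : T ⁻¹' B = B := by
    ext x
    simp only [hB, Set.mem_preimage, Set.mem_ofPred_eq, bddAbove_def, Set.forall_mem_range]
    constructor
    · rintro ⟨C, hC⟩
      refine ⟨max 0 (g x + C), fun n => (bmax_mono T g n x).trans ?_⟩
      have := hC n
      change max 0 (g x + bmax T g n (T x)) ≤ _
      gcongr
    · rintro ⟨C, hC⟩
      refine ⟨C - g x, fun n => ?_⟩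
      have := (le_max_right _ _).trans (hC (n+1))
      linarith
  have hAm : MeasurableSet Bᶜ := hBm.compl
  have hAT : T ⁻¹' Bᶜ = Bᶜ := by rw [Set.preimage_compl, hBT]
  have hTr : MeasurePreserving T (μ.restrict Bᶜ) (μ.restrict Bᶜ) := by
    have := hT.restrict_preimage hAm
    rwa [hAT] at this
  have hnn : ∀ n, 0 ≤ ∫ x in Bᶜ, (bmax T g (n+1) x - bmax T g n (T x)) ∂μ := by
    intro n
    have i1 := (bmax_int hT hg (n+1)).restrict (s := Bᶜ)
    have i0 := (bmax_int hT hg n).restrict (s := Bᶜ)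
    have i2 : Integrable (fun x => bmax T g n (T x)) (μ.restrict Bᶜ) :=
      hTr.integrable_comp_of_integrable i0
    rw [integral_sub i1 i2]
    have : ∫ x in Bᶜ, bmax T g n (T x) ∂μ = ∫ x in Bᶜ, bmax T g n x ∂μ := by
      conv_rhs => rw [← hTr.map_eq]
      rw [integral_map hTr.measurable.aemeasurable
        (bmax_meas hT.measurable hm n).aestronglyMeasurable]
    rw [this, sub_nonneg]
    exact integral_mono i0 i1 (bmax_mono T g n)
  have hlim : Tendsto (fun n => ∫ x in Bᶜ, (bmax T g (n+1) x - bmax T g n (T x)) ∂μ) atTop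
      (𝓝 (∫ x in Bᶜ, g x ∂μ)) := by
    refine tendsto_integral_of_dominated_convergence (fun x => |g x|) ?_ hg.abs.restrict ?_ ?_
    · intro n
      exact ((bmax_meas hT.measurable hm (n+1)).sub
        ((bmax_meas hT.measurable hm n).comp hT.measurable)).aestronglyMeasurable
    · intro n
      refine ae_of_all _ fun x => ?_
      have h0 := bmax_nonneg T g n (T x)
      change |max 0 (g x + bmax T g n (T x)) - bmax T g n (T x)| ≤ _
      rw [abs_le]
      have := neg_abs_le (g x)
      have := le_abs_self (g x)
      have := abs_nonneg (g x)
      rcases max_cases 0 (g x + bmax T g n (T x)) with h | h <;> constructor <;> linarith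
    · filter_upwards [ae_restrict_mem hAm] with x hx
      have hx' : T x ∈ Bᶜ := by rw [← hAT] at hx; exact hx
      have : ∃ N, - g x ≤ bmax T g N (T x) := by
        by_contra! hc
        apply hx'
        refine ⟨- g x, ?_⟩
        rintro _ ⟨n, rfl⟩
        exact (hc n).le
      obtain ⟨N, hN⟩ := this
      refine tendsto_const_nhds.congr' ?_
      filter_upwards [eventually_ge_atTop N] with n hn
      have h1 : bmax T g N (T x) ≤ bmax T g n (T x) :=
        monotone_nat_of_le_succ (f := fun n => bmax T g n (T x)) (fun n => bmax_mono T g n (T x)) hn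
      change _ = max 0 (g x + bmax T g n (T x)) - bmax T g n (T x)
      rw [max_eq_right (by linarith)]; ring
  have h0 := ge_of_tendsto' hlim hnn
  rw [h _ (MeasurableSpace.measurableSet_invariants.2 ⟨hAm, hAT⟩)] at h0
  have h1 : μ.real Bᶜ = 0 := le_antisymm (by nlinarith) measureReal_nonneg
  exact (measureReal_eq_zero_iff).1 h1

lemma birk_le {X : Type*} [MeasurableSpace X] {μ : Measure X} [IsProbabilityMeasure μ]
    {T : X → X} {f : X → ℝ} (hT : MeasurePreserving T μ μ) (hm : Measurable f)
    (hf : Integrable f μ) (ε : ℝ) (hε : 0 < ε) :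
    ∀ᵐ x ∂μ, ∀ᶠ n : ℕ in atTop, (n : ℝ)⁻¹ * ∑ i ∈ Finset.range n, f (T^[i] x)
      ≤ (μ[f | MeasurableSpace.invariants T]) x + 2 * ε := by
  have hle : MeasurableSpace.invariants T ≤ ‹MeasurableSpace X› := MeasurableSpace.invariants_le T
  set E := μ[f | MeasurableSpace.invariants T] with hE
  have hEm : Measurable[MeasurableSpace.invariants T] E := stronglyMeasurable_condExp.measurable
  have hET : E ∘ T = E := MeasurableSpace.comp_eq_of_measurable_invariants hEm
  have hEi : ∀ i x, E (T^[i] x) = E x := by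
    intro i
    induction i with
    | zero => intro x; rfl
    | succ i ih => intro x; rw [Function.iterate_succ, Function.comp, ih]; exact congrFun hET x
  have hEint : Integrable E μ := integrable_condExp
  have hb := bmax_bdd (g := fun x => f x - E x - ε) hT
    ((hm.sub (hEm.mono hle le_rfl)).sub measurable_const)
    ((hf.sub hEint).sub (integrable_const _)) ε hε (by
      intro A hA
      have i2 : Integrable (fun x => f x - E x) (μ.restrict A) := (hf.sub hEint).restrict
      rw [integral_sub i2 (integrable_const _),
        integral_sub hf.restrict hEint.restrict, hE, setIntegral_condExp hle hf hA]
      simp [mul_comm])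
  filter_upwards [hb] with x ⟨C, hC⟩
  have ht : Tendsto (fun n : ℕ => (n : ℝ)⁻¹ * C) atTop (𝓝 (0 * C)) :=
    tendsto_inv_atTop_nhds_zero_nat.mul_const C
  rw [zero_mul] at ht
  filter_upwards [ht.eventually_lt_const hε, eventually_gt_atTop 0] with n hn hn0
  have h1 := (sum_le_bmax T (fun x => f x - E x - ε) n x).trans (hC ⟨n, rfl⟩)
  simp only [hEi, Finset.sum_sub_distrib, Finset.sum_const, Finset.card_range, nsmul_eq_mul] at h1
  have hn' : (0:ℝ) < n := by exact_mod_cast hn0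
  have h2 := mul_le_mul_of_nonneg_left h1 (inv_nonneg.2 hn'.le)
  have h3 : (n:ℝ)⁻¹ * n = 1 := inv_mul_cancel₀ hn'.ne'
  linear_combination h2 + hn + (E x + ε) * h3

lemma birk_tendsto {X : Type*} [MeasurableSpace X] {μ : Measure X} [IsProbabilityMeasure μ]
    {T : X → X} {f : X → ℝ} (hT : MeasurePreserving T μ μ) 
    (hf : Integrable f μ) :
    ∀ᵐ x ∂μ, Tendsto (fun n : ℕ => (n : ℝ)⁻¹ * ∑ i ∈ Finset.range n, f (T^[i] x)) atTop
      (𝓝 ((μ[f | MeasurableSpace.invariants T]) x)) := by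
  wlog hm : Measurable f generalizing f
  · obtain ⟨g, hg, hfg⟩ := hf.1.aemeasurable
    have hc : μ[f | MeasurableSpace.invariants T] =ᵐ[μ] μ[g | MeasurableSpace.invariants T] :=
      condExp_congr_ae hfg
    have ho : ∀ᵐ x ∂μ, ∀ i, f (T^[i] x) = g (T^[i] x) :=
      ae_all_iff.2 fun i => (hT.iterate i).quasiMeasurePreserving.ae hfg
    filter_upwards [this (hf.congr hfg) hg, hc, ho] with x h1 h2 h3
    simpa only [h2, h3] using h1
  have hu : ∀ᵐ x ∂μ, ∀ k : ℕ, _ := ae_all_iff.2 fun k : ℕ =>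
    birk_le hT hm hf (1 / ((k:ℝ) + 1)) (by positivity)
  have hl : ∀ᵐ x ∂μ, ∀ k : ℕ, _ := ae_all_iff.2 fun k : ℕ =>
    birk_le hT hm.neg hf.neg (1 / ((k:ℝ) + 1)) (by positivity)
  filter_upwards [hu, hl, condExp_neg f (MeasurableSpace.invariants T) (μ := μ)] with x h1 h2 h3
  rw [Metric.tendsto_atTop']
  intro ε hε
  obtain ⟨k, hk⟩ := exists_nat_one_div_lt (show 0 < ε / 2 by linarith)
  obtain ⟨N, hN⟩ := eventually_atTop.1 ((h1 k).and (h2 k))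
  refine ⟨N, fun n hn => ?_⟩
  obtain ⟨a, b⟩ := hN n hn.le
  rw [h3] at b
  simp only [Pi.neg_apply, Finset.sum_neg_distrib, mul_neg] at b
  rw [Real.dist_eq, abs_lt]
  constructor <;> linarith

/-- For an invertible measure-preserving transformation `T` of a probability space
(with measurable inverse `S`), the forward and backward Birkhoff averages of any
integrable function converge almost everywhere to a common value. -/
theorem stmt11 {X : Type*} [MeasurableSpace X] (μ : Measure X) [IsProbabilityMeasure μ]
    (T S : X → X)
    (hleft : Function.LeftInverse S T) (hright : Function.RightInverse S T)
    (hT : Measurable T) (hS : Measurable S)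
    (hpres : MeasurePreserving T μ μ)
    (φ : X → ℝ) (hφ : Integrable φ μ) :
    ∀ᵐ x ∂μ, ∃ c : ℝ,
      Tendsto (fun n : ℕ => (n : ℝ)⁻¹ * ∑ i ∈ Finset.range n, φ (T^[i] x))
        atTop (𝓝 c) ∧
      Tendsto (fun n : ℕ => (n : ℝ)⁻¹ * ∑ i ∈ Finset.range n, φ (S^[i] x))
        atTop (𝓝 c) := by
  have hSp : MeasurePreserving S μ μ := by
    refine ⟨hS, ?_⟩
    conv_lhs => rw [← hpres.map_eq]
    rw [Measure.map_map hS hT, hleft.comp_eq_id, Measure.map_id]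
  have hI : MeasurableSpace.invariants S = MeasurableSpace.invariants T := by
    ext A
    simp only [MeasurableSpace.measurableSet_invariants]
    refine and_congr_right fun _ => ⟨fun h => ?_, fun h => ?_⟩
    · conv_lhs => rw [← h]
      rw [← Set.preimage_comp, hleft.comp_eq_id, Set.preimage_id]
    · conv_lhs => rw [← h]
      rw [← Set.preimage_comp, Function.RightInverse.comp_eq_id hright, Set.preimage_id]
  have h2 := birk_tendsto hSp hφ
  rw [hI] at h2
  filter_upwards [birk_tendsto hpres hφ, h2] with x a b
  exact ⟨_, a, b⟩
end
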